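/- Combining Page's formula with the harmonic sum asymptotics: for d_A ≤ d_Ā, the average entanglement entropy of a Haar-random state equals ln d_A − d_A/(2 d_Ā) + ε, where |ε| ≤ C/(d_A d_Ā) for an absolute constant C. -/

import Mathlib

open Matrix BigOperators MeasureTheory

/-- The reduced density matrix of a pure state `ψ` on `ℂ^{d_A} ⊗ ℂ^{d_Ā}`. -/
noncomputable def reducedDM {dA dB : ℕ} (ψ : Fin dA × Fin dB → ℂ) :
    Matrix (Fin dA) (Fin dA) ℂ :=
  fun k k' => ∑ l : Fin dB, ψ (k, l) * (starRingEnd ℂ) (ψ (k', l))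

/-- The von Neumann entropy `-Tr(ρ ln ρ)` of a Hermitian matrix, via its eigenvalues. -/
noncomputable def vnEntropy {n : ℕ} (ρ : Matrix (Fin n) (Fin n) ℂ) : ℝ :=
  if h : ρ.IsHermitian then ∑ i, Real.negMulLog (h.eigenvalues i) else 0

/-- squared norm -/
noncomputable def sqn {ι : Type*} [Fintype ι] (v : ι → ℂ) : ℝ := ∑ i, Complex.normSq (v i)

lemma sqn_nonneg {ι : Type*} [Fintype ι] (v : ι → ℂ) : 0 ≤ sqn v :=
  Finset.sum_nonneg fun i _ => Complex.normSq_nonneg _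

lemma sqn_cont {ι : Type*} [Fintype ι] : Continuous (sqn : (ι → ℂ) → ℝ) := by
  unfold sqn
  exact continuous_finsetSum _ fun i _ => Complex.continuous_normSq.comp (continuous_apply i)

lemma sqn_eq_zero {ι : Type*} [Fintype ι] (v : ι → ℂ) : sqn v = 0 ↔ v = 0 := by
  unfold sqn
  rw [Finset.sum_eq_zero_iff_of_nonneg (fun i _ => Complex.normSq_nonneg _)]
  simp [funext_iff]

lemma sqn_smul {ι : Type*} [Fintype ι] (c : ℂ) (v : ι → ℂ) :
    sqn (c • v) = Complex.normSq c * sqn v := by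
  simp [sqn, Finset.mul_sum]

lemma sqn_dot {ι : Type*} [Fintype ι] (v : ι → ℂ) : ((sqn v : ℝ) : ℂ) = star v ⬝ᵥ v := by
  simp only [sqn, dotProduct, Complex.ofReal_sum, Complex.normSq_eq_conj_mul_self]; rfl

lemma sqn_norm {ι : Type*} [Fintype ι] (v : ι → ℂ) :
    ‖(WithLp.toLp 2 v : EuclideanSpace ℂ ι)‖ ^ 2 = sqn v := by
  rw [EuclideanSpace.norm_sq_eq]; simp [sqn, Complex.normSq_eq_norm_sq]

lemma unit_star_mulVec {ι : Type*} [Fintype ι] [DecidableEq ι] {U : Matrix ι ι ℂ}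
    (hU : U ∈ unitaryGroup ι ℂ) (v w : ι → ℂ) : star (U *ᵥ v) ⬝ᵥ (U *ᵥ w) = star v ⬝ᵥ w := by
  rw [star_mulVec, dotProduct_mulVec, vecMul_vecMul, ← star_eq_conjTranspose,
    mem_unitaryGroup_iff'.1 hU, vecMul_one]

lemma sqn_unitary {ι : Type*} [Fintype ι] [DecidableEq ι] {U : Matrix ι ι ℂ}
    (hU : U ∈ unitaryGroup ι ℂ) (v : ι → ℂ) : sqn (U *ᵥ v) = sqn v := by
  have := unit_star_mulVec hU v v
  rw [← sqn_dot, ← sqn_dot] at this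
  exact_mod_cast this

lemma mulVec_cont {ι κ : Type*} [Fintype ι] (U : Matrix κ ι ℂ) :
    Continuous (fun v : ι → ℂ => U *ᵥ v) := by fun_prop

lemma vol_pres {ι : Type*} [Fintype ι] [DecidableEq ι] {U : Matrix ι ι ℂ}
    (hU : U ∈ unitaryGroup ι ℂ) :
    MeasurePreserving (fun v : ι → ℂ => U *ᵥ v) volume volume := by
  refine ⟨(mulVec_cont U).measurable, ?_⟩
  have h1 : Complex.normSq U.det = 1 := by
    have := congrArg Matrix.det (mem_unitaryGroup_iff'.1 hU)
    rw [det_mul, star_eq_conjTranspose, det_conjTranspose, det_one] at this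
    have h2 : ((Complex.normSq U.det : ℝ) : ℂ) = 1 := by
      rw [Complex.normSq_eq_conj_mul_self]; exact this
    exact_mod_cast h2
  have hd : LinearMap.det ((Matrix.toLin' U).restrictScalars ℝ) = 1 := by
    rw [LinearMap.det_restrictScalars, LinearMap.det_toLin', Algebra.norm_complex_apply, h1]
  have := Measure.map_linearMap_addHaar_eq_smul_addHaar (volume : Measure (ι → ℂ))
    (f := (Matrix.toLin' U).restrictScalars ℝ) (by rw [hd]; exact one_ne_zero)
  rw [hd] at this
  have h3 : (fun v : ι → ℂ => U *ᵥ v) = ⇑((Matrix.toLin' U).restrictScalars ℝ) := by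
    ext v; simp
  rw [h3, this]
  simp

lemma exists_unitary {ι : Type*} [Fintype ι] [DecidableEq ι] (v w : ι → ℂ)
    (hv : sqn v = 1) (hw : sqn w = 1) : ∃ U ∈ unitaryGroup ι ℂ, U *ᵥ v = w := by
  let v' : EuclideanSpace ℂ ι := WithLp.toLp 2 v
  let w' : EuclideanSpace ℂ ι := WithLp.toLp 2 w
  have hv' : ‖v'‖ = 1 := by
    have := sqn_norm v
    rw [hv] at this
    exact (pow_eq_one_iff_of_nonneg (norm_nonneg _) two_ne_zero).1 this
  have hw' : ‖w'‖ = 1 := by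
    have := sqn_norm w
    rw [hw] at this
    exact (pow_eq_one_iff_of_nonneg (norm_nonneg _) two_ne_zero).1 this
  let L := (LinearIsometry.toSpanSingleton ℂ (EuclideanSpace ℂ ι) hw').comp
    (LinearIsometryEquiv.toSpanUnitSingleton (𝕜 := ℂ) v' hv').symm.toLinearIsometry
  let T := L.extend
  have hT : T v' = w' := by
    have h1 := LinearIsometry.extend_apply L
      (LinearIsometryEquiv.toSpanUnitSingleton (𝕜 := ℂ) v' hv' 1)
    have h2 : ((LinearIsometryEquiv.toSpanUnitSingleton (𝕜 := ℂ) v' hv' 1 :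
      Submodule.span ℂ {v'}) : EuclideanSpace ℂ ι) = v' := by simp
    rw [h2] at h1
    rw [h1]
    show (LinearIsometry.toSpanSingleton ℂ (EuclideanSpace ℂ ι) hw')
      ((LinearIsometryEquiv.toSpanUnitSingleton (𝕜 := ℂ) v' hv').symm
        (LinearIsometryEquiv.toSpanUnitSingleton (𝕜 := ℂ) v' hv' 1)) = w'
    rw [LinearIsometryEquiv.symm_apply_apply]
    simp
  let U : Matrix ι ι ℂ := Matrix.of fun i j => T (EuclideanSpace.single j 1) i
  have hUmul : ∀ x : ι → ℂ, U *ᵥ x = (T (WithLp.toLp 2 x)).ofLp := by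
    intro x
    have hx : (WithLp.toLp 2 x : EuclideanSpace ℂ ι) = ∑ j, x j • EuclideanSpace.single j (1:ℂ) := by
      ext i
      simp [Finset.sum_apply, Pi.single_apply]
    rw [hx, map_sum]
    ext i
    simp [mulVec, dotProduct, U, mul_comm]
  refine ⟨U, ?_, ?_⟩
  · rw [mem_unitaryGroup_iff']
    ext i j
    have := T.inner_map_map (EuclideanSpace.single i (1:ℂ)) (EuclideanSpace.single j 1)
    rw [EuclideanSpace.inner_eq_star_dotProduct] at this
    simp only [star_eq_conjTranspose, mul_apply, conjTranspose_apply, U, of_apply]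
    rw [dotProduct] at this
    simp only [Pi.star_apply] at this
    rw [one_apply]
    calc _ = _ := Finset.sum_congr rfl fun k _ => mul_comm _ _
      _ = _ := this
      _ = _ := by simp [EuclideanSpace.inner_single_left, Pi.single_apply]
  · rw [hUmul]
    show (T v').ofLp = w
    rw [hT]

/-- real bilinear form -/
noncomputable def bilRe (ι : Type*) [Fintype ι] : (ι → ℂ) →ₗ[ℝ] (ι → ℂ) →ₗ[ℝ] ℝ :=
  LinearMap.mk₂ ℝ (fun x y => (star y ⬝ᵥ x).re)
    (by intro a b c; simp [dotProduct_add])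
    (by intro a b c; simp [dotProduct_smul])
    (by intro a b c; simp [add_dotProduct])
    (by intro a b c; simp [smul_dotProduct])

lemma bilRe_apply {ι : Type*} [Fintype ι] (x y : ι → ℂ) : bilRe ι x y = (star y ⬝ᵥ x).re := rfl

lemma bilRe_comm {ι : Type*} [Fintype ι] (x y : ι → ℂ) : bilRe ι x y = bilRe ι y x := by
  rw [bilRe_apply, bilRe_apply, ← Complex.conj_re (star x ⬝ᵥ y)]
  congr 1
  simp [dotProduct, mul_comm]

lemma unique_inv {ι : Type*} [Fintype ι] [DecidableEq ι] (μ ν : Measure (ι → ℂ))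
    [IsProbabilityMeasure μ] [IsProbabilityMeasure ν]
    (hμ1 : ∀ᵐ ψ ∂μ, sqn ψ = 1) (hν1 : ∀ᵐ ψ ∂ν, sqn ψ = 1)
    (hμ : ∀ U ∈ unitaryGroup ι ℂ, μ.map (fun ψ => U *ᵥ ψ) = μ)
    (hν : ∀ U ∈ unitaryGroup ι ℂ, ν.map (fun ψ => U *ᵥ ψ) = ν) : μ = ν := by
  have hL : Continuous fun p : (ι → ℂ) × (ι → ℂ) => bilRe ι p.1 p.2 := by
    simp only [bilRe_apply, dotProduct]
    exact Complex.continuous_re.comp (continuous_finsetSum _ fun i _ => by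
      simp only [Pi.star_apply]; fun_prop)
  let φ : Measure (ι → ℂ) → (ι → ℂ) → ℂ := fun P w => ∫ v, Complex.exp (bilRe ι v w * Complex.I) ∂P
  have hinv : ∀ (P : Measure (ι → ℂ)), (∀ U ∈ unitaryGroup ι ℂ, P.map (fun ψ => U *ᵥ ψ) = P) →
      ∀ U ∈ unitaryGroup ι ℂ, ∀ w, φ P (U *ᵥ w) = φ P w := by
    intro P hP U hU w
    simp only [φ]
    conv_lhs => rw [← hP U hU]
    rw [integral_map (mulVec_cont U).aemeasurable]
    · refine integral_congr_ae (Filter.Eventually.of_forall fun v => ?_)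
      simp only [bilRe_apply, unit_star_mulVec hU]
    · refine Continuous.aestronglyMeasurable ?_
      have : Continuous fun v => bilRe ι v (U *ᵥ w) := hL.comp (Continuous.prodMk_left (U *ᵥ w))
      fun_prop
  have hrad : ∀ (P : Measure (ι → ℂ)), (∀ U ∈ unitaryGroup ι ℂ, P.map (fun ψ => U *ᵥ ψ) = P) →
      ∀ (r : ℝ) (v w : ι → ℂ), sqn v = 1 → sqn w = 1 → φ P ((r:ℂ) • v) = φ P ((r:ℂ) • w) := by
    intro P hP r v w hv hw
    obtain ⟨U, hU, hUv⟩ := exists_unitary v w hv hw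
    rw [← hUv, ← mulVec_smul, hinv P hP U hU]
  have key : ∀ (r : ℝ) (y : ι → ℂ), sqn y = 1 → φ μ ((r:ℂ) • y) = φ ν ((r:ℂ) • y) := by
    intro r y hy
    have e1 : φ μ ((r:ℂ) • y) = ∫ ω, φ μ ((r:ℂ) • ω) ∂ν := by
      rw [integral_congr_ae (g := fun _ => φ μ ((r:ℂ) • y))]
      · simp
      · filter_upwards [hν1] with ω hω using hrad μ hμ r _ _ hω hy
    have e2 : φ ν ((r:ℂ) • y) = ∫ ω, φ ν ((r:ℂ) • ω) ∂μ := by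
      rw [integral_congr_ae (g := fun _ => φ ν ((r:ℂ) • y))]
      · simp
      · filter_upwards [hμ1] with ω hω using hrad ν hν r _ _ hω hy
    rw [e1, e2]
    simp only [φ]
    rw [integral_integral_swap]
    · refine integral_congr_ae (Filter.Eventually.of_forall fun v => ?_)
      refine integral_congr_ae (Filter.Eventually.of_forall fun w => ?_)
      simp only
      rw [bilRe_comm w]
      congr 3
      simp [bilRe_apply]
    · have hc : Continuous (Function.uncurry fun (x v : ι → ℂ) =>
        Complex.exp (bilRe ι v ((r:ℂ) • x) * Complex.I)) := by
        have : Continuous fun p : (ι → ℂ) × (ι → ℂ) => bilRe ι p.2 ((r:ℂ) • p.1) :=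
          hL.comp (by fun_prop : Continuous fun p : (ι → ℂ) × (ι → ℂ) => (p.2, (r:ℂ) • p.1))
        simp only [Function.uncurry_def]
        fun_prop
      refine Integrable.of_bound hc.aestronglyMeasurable 1 (Filter.Eventually.of_forall fun p => ?_)
      simp only [Function.uncurry_def]
      rw [Complex.norm_exp_ofReal_mul_I]
  refine ext_of_integral_char_eq (L := bilRe ι) (e := Real.probChar) Real.continuous_probChar
    Real.probChar_ne_one ?_ hL ?_
  · intro v hv h
    have : bilRe ι v v = 0 := by rw [h]; rfl
    rw [bilRe_apply, ← sqn_dot, Complex.ofReal_re, sqn_eq_zero] at this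
    exact hv this
  · intro w
    have h0 : ∀ P : Measure (ι → ℂ), ∫ v, (BoundedContinuousFunction.char Real.continuous_probChar hL w) v ∂P
      = φ P w := fun P => rfl
    rw [h0, h0]
    by_cases hw : w = 0
    · subst hw; simp [φ, bilRe_apply]
    · have hs : 0 < sqn w := lt_of_le_of_ne (sqn_nonneg w) (fun h => hw ((sqn_eq_zero w).1 h.symm))
      have hne : (Real.sqrt (sqn w) : ℂ) ≠ 0 := by
        exact_mod_cast (Real.sqrt_pos.2 hs).ne'
      have := key (Real.sqrt (sqn w)) (((Real.sqrt (sqn w))⁻¹ : ℂ) • w) ?_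
      · rwa [smul_smul, mul_inv_cancel₀ hne, one_smul] at this
      · rw [sqn_smul, ← Complex.ofReal_inv, Complex.normSq_ofReal, ← mul_inv,
          Real.mul_self_sqrt hs.le, inv_mul_cancel₀ hs.ne']

lemma gint0 {a : ℝ} (ha : 0 < a) : ∫ z : ℂ, Real.exp (-(a * Complex.normSq z)) = Real.pi / a := by
  have := GaussianFourier.integral_rexp_neg_mul_sq_norm (V := ℂ) ha
  simp only [Complex.finrank_real_complex] at this
  norm_num at this
  rw [← this]
  simp [Complex.normSq_eq_norm_sq]

lemma gint0_int {a : ℝ} (ha : 0 < a) : Integrable fun z : ℂ => Real.exp (-(a * Complex.normSq z)) := by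
  apply Integrable.of_integral_ne_zero
  rw [gint0 ha]
  have := Real.pi_pos
  positivity

lemma gint2 {a : ℝ} (ha : 0 < a) :
    ∫ z : ℂ, Complex.normSq z * Real.exp (-(a * Complex.normSq z)) = Real.pi / a * (1 / a) := by
  have := Complex.integral_rpow_mul_exp_neg_mul_rpow (p := 2) (q := 2) (b := a) (by norm_num)
    (by norm_num) ha
  norm_num at this
  simp only [Complex.normSq_eq_norm_sq]
  rw [this]
  field_simp

lemma gint2_int {a : ℝ} (ha : 0 < a) :
    Integrable fun z : ℂ => Complex.normSq z * Real.exp (-(a * Complex.normSq z)) := by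
  apply Integrable.of_integral_ne_zero
  rw [gint2 ha]
  have := Real.pi_pos
  positivity

lemma gint1 (a : ℝ) : ∫ z : ℂ, z * (Real.exp (-(a * Complex.normSq z)) : ℂ) = 0 := by
  have h := integral_neg_eq_self (fun z : ℂ => z * (Real.exp (-(a * Complex.normSq z)) : ℂ)) volume
  simp only [Complex.normSq_neg, neg_mul] at h
  rw [integral_neg] at h
  exact self_eq_neg.1 h.symm

/-- diagonal Gaussian weight -/
noncomputable def gw {m : ℕ} (a : Fin m → ℝ) (v : Fin m → ℂ) : ℝ :=
  ∏ i, Real.exp (-(a i * Complex.normSq (v i)))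

lemma gw_cont {m : ℕ} (a : Fin m → ℝ) : Continuous (gw a) := by
  unfold gw
  refine continuous_finsetProd _ fun i _ => ?_
  exact Real.continuous_exp.comp ((continuous_const.mul
    (Complex.continuous_normSq.comp (continuous_apply i))).neg)

lemma gw_nonneg {m : ℕ} (a : Fin m → ℝ) (v) : 0 ≤ gw a v :=
  Finset.prod_nonneg fun i _ => (Real.exp_pos _).le

lemma gw_one {m : ℕ} (v : Fin m → ℂ) : gw 1 v = Real.exp (- sqn v) := by
  simp [gw, sqn, ← Real.exp_sum]

lemma gw_eq {m : ℕ} (a : Fin m → ℝ) (v : Fin m → ℂ) :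
    gw a v = Real.exp (- ∑ i, a i * Complex.normSq (v i)) := by
  simp [gw, ← Real.exp_sum]

lemma gw_int {m : ℕ} {a : Fin m → ℝ} (ha : ∀ i, 0 < a i) : Integrable (gw a) :=
  Integrable.fintype_prod (f := fun i (z : ℂ) => Real.exp (-(a i * Complex.normSq z)))
    fun i => gint0_int (ha i)

lemma gw_integral {m : ℕ} {a : Fin m → ℝ} (ha : ∀ i, 0 < a i) :
    ∫ v, gw a v = ∏ i, Real.pi / a i := by
  unfold gw
  rw [integral_fintype_prod_volume_eq_prod (fun i (z : ℂ) => Real.exp (-(a i * Complex.normSq z)))]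
  exact Finset.prod_congr rfl fun i _ => gint0 (ha i)

lemma gw_moment {m : ℕ} {a : Fin m → ℝ} (ha : ∀ i, 0 < a i) (i j : Fin m) :
    ∫ v, (gw a v : ℂ) * (v i * star (v j)) =
      if i = j then ((∏ k, Real.pi / a k : ℝ) : ℂ) * ((1 / a i : ℝ) : ℂ) else 0 := by
  split_ifs with h
  · subst h
    have h1 : ∀ v : Fin m → ℂ, (gw a v : ℂ) * (v i * star (v i)) =
        ((∏ k, (if k = i then Complex.normSq (v k) * Real.exp (-(a k * Complex.normSq (v k))) else
          Real.exp (-(a k * Complex.normSq (v k)))) : ℝ) : ℂ) := by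
      intro v
      have : v i * star (v i) = (Complex.normSq (v i) : ℂ) := by
        rw [Complex.normSq_eq_conj_mul_self, mul_comm]; rfl
      rw [this, ← Complex.ofReal_mul]
      congr 1
      have h2 : ∀ k, (if k = i then Complex.normSq (v k) * Real.exp (-(a k * Complex.normSq (v k))) else
          Real.exp (-(a k * Complex.normSq (v k)))) =
          (if k = i then Complex.normSq (v k) else 1) * Real.exp (-(a k * Complex.normSq (v k))) := by
        intro k; split_ifs <;> simp
      simp_rw [h2, Finset.prod_mul_distrib]
      simp [gw, mul_comm]
    simp_rw [h1]
    rw [integral_complex_ofReal, ← Complex.ofReal_mul]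
    congr 1
    rw [integral_fintype_prod_volume_eq_prod (fun k (z : ℂ) =>
      if k = i then Complex.normSq z * Real.exp (-(a k * Complex.normSq z)) else
          Real.exp (-(a k * Complex.normSq z)))]
    have h3 : ∀ k, (∫ z : ℂ, if k = i then Complex.normSq z * Real.exp (-(a k * Complex.normSq z)) else
          Real.exp (-(a k * Complex.normSq z))) = Real.pi / a k * (if k = i then 1 / a k else 1) := by
      intro k
      split_ifs with hk
      · exact gint2 (ha k)
      · rw [gint0 (ha k), mul_one]
    simp_rw [h3, Finset.prod_mul_distrib]
    simp
  · have h1 : ∀ v : Fin m → ℂ, (gw a v : ℂ) * (v i * star (v j)) =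
        ∏ k, ((if k = i then v k else if k = j then star (v k) else 1) *
          (Real.exp (-(a k * Complex.normSq (v k))) : ℂ)) := by
      intro v
      rw [Finset.prod_mul_distrib, mul_comm]
      congr 1
      · rw [← Finset.mul_prod_erase _ _ (Finset.mem_univ i), if_pos rfl]
        congr 1
        rw [← Finset.mul_prod_erase _ _ (Finset.mem_erase.2 ⟨fun h' => h h'.symm, Finset.mem_univ j⟩),
          if_neg (fun h' => h h'.symm), if_pos rfl, Finset.prod_eq_one, mul_one]
        intro k hk
        simp only [Finset.mem_erase] at hk
        rw [if_neg hk.2.1, if_neg hk.1]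
      · simp [gw]
    simp_rw [h1]
    rw [integral_fintype_prod_volume_eq_prod (fun k (z : ℂ) =>
      (if k = i then z else if k = j then star z else 1) *
          (Real.exp (-(a k * Complex.normSq z)) : ℂ))]
    apply Finset.prod_eq_zero (Finset.mem_univ i)
    simpa using gint1 (a i)

lemma gw_moment_int {m : ℕ} {a : Fin m → ℝ} (ha : ∀ i, 0 < a i) (i j : Fin m) :
    Integrable fun v => (gw a v : ℂ) * (v i * star (v j)) := by
  have hs : Integrable fun v => ∑ k, (gw a v : ℂ) * (v k * star (v k)) := by
    refine integrable_finsetSum _ fun k _ => ?_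
    apply Integrable.of_integral_ne_zero
    rw [gw_moment ha, if_pos rfl, ← Complex.ofReal_mul]
    have h1 : 0 < ∏ k, Real.pi / a k := Finset.prod_pos fun k _ => div_pos Real.pi_pos (ha k)
    have h2 := ha k
    exact_mod_cast (by positivity : (0:ℝ) < (∏ k, Real.pi / a k) * (1 / a k)).ne'
  refine hs.mono ?_ ?_
  · refine Continuous.aestronglyMeasurable ?_
    have := gw_cont a
    fun_prop
  · refine Filter.Eventually.of_forall fun v => ?_
    have e : ∑ k, (gw a v : ℂ) * (v k * star (v k)) = ((gw a v * sqn v : ℝ) : ℂ) := by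
      rw [Complex.ofReal_mul, sqn_dot, dotProduct, Finset.mul_sum]
      exact Finset.sum_congr rfl fun k _ => by rw [mul_comm (v k)]; rfl
    rw [e, Complex.norm_real, norm_mul, norm_mul, norm_mul, Complex.norm_real, norm_star]
    refine mul_le_mul_of_nonneg_left ?_ (norm_nonneg _)
    have hk : ∀ k, ‖v k‖ ^ 2 ≤ sqn v := fun k => by
      rw [← Complex.normSq_eq_norm_sq]
      exact Finset.single_le_sum (f := fun k => Complex.normSq (v k))
        (fun i _ => Complex.normSq_nonneg _) (Finset.mem_univ k)
    rw [Real.norm_of_nonneg (sqn_nonneg v)]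
    nlinarith [hk i, hk j, sq_nonneg (‖v i‖ - ‖v j‖)]

lemma det_rank_one {m : ℕ} (M : Matrix (Fin m) (Fin m) ℂ) (u v : Fin m → ℂ) :
    (M + vecMulVec u v).det = M.det + v ⬝ᵥ (adjugate M *ᵥ u) := by
  have hinv : ∀ A : Matrix (Fin m) (Fin m) ℂ, A.det ≠ 0 →
      (A + vecMulVec u v).det = A.det + v ⬝ᵥ (adjugate A *ᵥ u) := by
    intro A hA
    have h := det_add_replicateCol_mul_replicateRow (ι := Unit) (A := A) (isUnit_iff_ne_zero.2 hA) u v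
    rw [← vecMulVec_eq] at h
    rw [h, det_unique (1 + _ : Matrix Unit Unit ℂ)]
    have h2 : (replicateRow Unit v * A⁻¹ * replicateCol Unit u) default default = v ⬝ᵥ (A⁻¹ *ᵥ u) := by
      rw [Matrix.mul_assoc]
      rfl
    rw [Matrix.add_apply, h2, inv_def, Ring.inverse_eq_inv', smul_mulVec, dotProduct_smul, smul_eq_mul]
    simp only [one_apply_eq]
    field_simp
  have hne : ∀ᶠ e in nhdsWithin (0:ℂ) {0}ᶜ, (M + e • (1 : Matrix (Fin m) (Fin m) ℂ)).det ≠ 0 := by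
    have hfin : ((-M).charpoly.rootSet ℂ).Finite := Polynomial.rootSet_finite _ _
    have hp : (-M).charpoly ≠ 0 := (charpoly_monic _).ne_zero
    have h0 : (((-M).charpoly.rootSet ℂ) \ {0})ᶜ ∈ nhds (0:ℂ) :=
      (hfin.subset Set.sdiff_subset).isClosed.isOpen_compl.mem_nhds (by simp)
    filter_upwards [nhdsWithin_le_nhds h0, self_mem_nhdsWithin] with e he he0 hdet
    apply he
    refine ⟨?_, he0⟩
    rw [Polynomial.mem_rootSet]
    refine ⟨hp, ?_⟩
    rw [Polynomial.coe_aeval_eq_eval, eval_charpoly]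
    rw [← hdet]
    congr 1
    ext i j
    simp [scalar_apply, diagonal_apply, one_apply, add_comm]
  have hf : Continuous fun e : ℂ => (M + e • (1 : Matrix (Fin m) (Fin m) ℂ) + vecMulVec u v).det := by
    fun_prop
  have hg : Continuous fun e : ℂ => (M + e • (1 : Matrix (Fin m) (Fin m) ℂ)).det +
      v ⬝ᵥ (adjugate (M + e • (1 : Matrix (Fin m) (Fin m) ℂ)) *ᵥ u) := by
    refine Continuous.add (by fun_prop) ?_
    refine Continuous.dotProduct continuous_const ?_
    refine Continuous.matrix_mulVec ?_ continuous_const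
    exact Continuous.matrix_adjugate (by fun_prop)
  have h1 := (hf.tendsto 0).mono_left (nhdsWithin_le_nhds (s := {0}ᶜ))
  have h2 := (hg.tendsto 0).mono_left (nhdsWithin_le_nhds (s := {0}ᶜ))
  have h3 := h1.congr' (hne.mono fun e he => hinv _ he)
  have := tendsto_nhds_unique h3 h2
  simpa using this

noncomputable def YY {n m : ℕ} (x : Fin n → Fin m → ℂ) : Matrix (Fin m) (Fin m) ℂ :=
  ∑ l, vecMulVec (x l) (star (x l))

noncomputable def RR {n m : ℕ} (x : Fin n → Fin m → ℂ) : ℝ := ∑ l, sqn (x l)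

lemma YY_cont {n m : ℕ} : Continuous (YY : (Fin n → Fin m → ℂ) → _) := by
  unfold YY
  refine continuous_finsetSum _ fun l _ => ?_
  exact Continuous.matrix_vecMulVec (continuous_apply l) (continuous_apply l).star

lemma RR_cont {n m : ℕ} : Continuous (RR : (Fin n → Fin m → ℂ) → _) := by
  unfold RR
  exact continuous_finsetSum _ fun l _ => sqn_cont.comp (continuous_apply l)

lemma RR_nonneg {n m : ℕ} (x : Fin n → Fin m → ℂ) : 0 ≤ RR x :=
  Finset.sum_nonneg fun _ _ => sqn_nonneg _

lemma exp_half_int {n m : ℕ} : Integrable fun x : Fin n → Fin m → ℂ => Real.exp (-(RR x / 2)) := by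
  have : (fun x : Fin n → Fin m → ℂ => Real.exp (-(RR x / 2))) = fun x => ∏ l, gw (fun _ => 1/2) (x l) := by
    ext x
    simp only [gw_eq, ← Real.exp_sum, RR, sqn]
    congr 1
    rw [Finset.sum_neg_distrib, Finset.sum_div]
    simp only [← Finset.mul_sum]
    rw [← Finset.sum_div]; ring
  rw [this]
  exact Integrable.fintype_prod (f := fun (_ : Fin n) => gw (m := m) (fun _ => 1/2))
    fun _ => gw_int fun _ => by norm_num

lemma poly_exp_bound (k : ℕ) : ∃ K : ℝ, 0 ≤ K ∧ ∀ r : ℝ, 0 ≤ r → (1 + r) ^ k * Real.exp (-r) ≤ K * Real.exp (-(r/2)) := by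
  refine ⟨2 ^ k * k.factorial * Real.exp (1/2), by positivity, fun r hr => ?_⟩
  have h := Real.pow_div_factorial_le_exp ((1 + r)/2) (by positivity) k
  rw [div_le_iff₀ (by positivity), div_pow, div_le_iff₀ (by positivity)] at h
  have e : Real.exp ((1+r)/2) * Real.exp (-r) = Real.exp (1/2) * Real.exp (-(r/2)) := by
    rw [← Real.exp_add, ← Real.exp_add]; congr 1; ring
  calc (1 + r) ^ k * Real.exp (-r) ≤ (Real.exp ((1+r)/2) * k.factorial * 2 ^ k) * Real.exp (-r) := by gcongr
    _ = 2 ^ k * k.factorial * (Real.exp ((1+r)/2) * Real.exp (-r)) := by ring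
    _ = _ := by rw [e]; ring

lemma X_int {n m : ℕ} {E : Type*} [NormedAddCommGroup E] {f : (Fin n → Fin m → ℂ) → E}
    (hf : AEStronglyMeasurable f volume) (K : ℝ) (k : ℕ)
    (hb : ∀ x, ‖f x‖ ≤ K * ((1 + RR x) ^ k * Real.exp (-RR x))) : Integrable f := by
  obtain ⟨K', hK', h⟩ := poly_exp_bound k
  have hK : ∀ x : Fin n → Fin m → ℂ, ‖f x‖ ≤ (|K| * K') * Real.exp (-(RR x / 2)) := fun x => by
    have h1 := h (RR x) (RR_nonneg x)
    have h0 : 0 ≤ (1 + RR x) ^ k * Real.exp (-RR x) := by have := RR_nonneg x; positivity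
    calc ‖f x‖ ≤ _ := hb x
      _ ≤ |K| * ((1 + RR x) ^ k * Real.exp (-RR x)) := by gcongr; exact le_abs_self K
      _ ≤ |K| * (K' * Real.exp (-(RR x / 2))) := by gcongr
      _ = _ := by ring
  exact (exp_half_int.const_mul (|K| * K')).mono' hf (Filter.Eventually.of_forall hK)

lemma YY_entry {n m : ℕ} (x : Fin n → Fin m → ℂ) (i j : Fin m) : ‖YY x i j‖ ≤ RR x := by
  unfold YY RR
  rw [Matrix.sum_apply]
  refine (norm_sum_le _ _).trans (Finset.sum_le_sum fun l _ => ?_)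
  rw [vecMulVec_apply, norm_mul, Pi.star_apply, norm_star]
  have hk : ∀ k, ‖x l k‖ ^ 2 ≤ sqn (x l) := fun k => by
      rw [← Complex.normSq_eq_norm_sq]
      exact Finset.single_le_sum (f := fun k => Complex.normSq (x l k))
        (fun i _ => Complex.normSq_nonneg _) (Finset.mem_univ k)
  nlinarith [hk i, hk j, sq_nonneg (‖x l i‖ - ‖x l j‖)]

lemma det_bound {m : ℕ} (M : Matrix (Fin m) (Fin m) ℂ) : ∃ K : ℝ, 0 ≤ K ∧ ∀ (n : ℕ) (x : Fin n → Fin m → ℂ),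
    ‖(M + YY x).det‖ ≤ K * (1 + RR x) ^ m := by
  obtain ⟨B, hB0, hB⟩ : ∃ B : ℝ, 0 ≤ B ∧ ∀ i j, ‖M i j‖ ≤ B := by
    refine ⟨∑ i, ∑ j, ‖M i j‖, by positivity, fun i j => ?_⟩
    refine le_trans ?_ (Finset.single_le_sum (f := fun i => ∑ j, ‖M i j‖) (fun i _ => by positivity) (Finset.mem_univ i))
    exact (Finset.single_le_sum (f := fun j => ‖M i j‖) (fun i _ => by positivity) (Finset.mem_univ j))
  refine ⟨m.factorial * (1 + B) ^ m, by positivity, fun n x => ?_⟩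
  have h := Matrix.det_le (A := M + YY x) (abv := NormedField.toAbsoluteValue ℂ) (x := (1 + B) * (1 + RR x)) (by
    intro i j
    change ‖M i j + YY x i j‖ ≤ _
    have := RR_nonneg x
    nlinarith [norm_add_le (M i j) (YY x i j), hB i j, YY_entry x i j, mul_nonneg hB0 this])
  rw [Fintype.card_fin, nsmul_eq_mul, mul_pow, ← mul_assoc] at h
  exact h

lemma gw_prod_le {n m : ℕ} {a : Fin m → ℝ} (ha : ∀ i, 1 ≤ a i) (x : Fin n → Fin m → ℂ) :
    ∏ l, gw a (x l) ≤ Real.exp (- RR x) := by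
  simp only [gw_eq, ← Real.exp_sum]
  rw [Real.exp_le_exp, Finset.sum_neg_distrib, neg_le_neg_iff]
  refine Finset.sum_le_sum fun l _ => Finset.sum_le_sum fun i _ => ?_
  have := Complex.normSq_nonneg (x l i)
  nlinarith [ha i]

lemma gw_det_int {n m : ℕ} {a : Fin m → ℝ} (ha : ∀ i, 1 ≤ a i) (M : Matrix (Fin m) (Fin m) ℂ) :
    Integrable fun x : Fin n → Fin m → ℂ => ((∏ l, gw a (x l) : ℝ) : ℂ) * (M + YY x).det := by
  obtain ⟨K, hK0, hK⟩ := det_bound M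
  refine X_int (Continuous.aestronglyMeasurable ?_) K m fun x => ?_
  · refine Continuous.mul (Complex.continuous_ofReal.comp ?_) ?_
    · exact continuous_finsetProd _ fun l _ => (gw_cont a).comp (continuous_apply l)
    · exact (continuous_const.add YY_cont).matrix_det
  · have h0 : 0 ≤ ∏ l, gw a (x l) := Finset.prod_nonneg fun l _ => gw_nonneg _ _
    rw [norm_mul, Complex.norm_real, Real.norm_of_nonneg h0]
    calc _ ≤ Real.exp (-RR x) * (K * (1 + RR x) ^ m) := by
          gcongr
          · exact gw_prod_le ha x
          · exact hK n x
      _ = _ := by ring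

lemma one_col {m : ℕ} {a : Fin m → ℝ} (ha : ∀ i, 0 < a i) (M : Matrix (Fin m) (Fin m) ℂ) :
    ∫ g : Fin m → ℂ, (gw a g : ℂ) * (M + vecMulVec g (star g)).det =
      ((∏ k, Real.pi / a k : ℝ) : ℂ) * (M.det + ∑ i, ((1 / a i : ℝ) : ℂ) * ((M + diagonal (Pi.single i 1)).det - M.det)) := by
  have h1 : ∀ g : Fin m → ℂ, (gw a g : ℂ) * (M + vecMulVec g (star g)).det =
     (gw a g : ℂ) * M.det + ∑ i, ∑ j, adjugate M i j * ((gw a g : ℂ) * (g j * star (g i))) := by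
    intro g
    rw [det_rank_one, mul_add]
    congr 1
    simp only [dotProduct, mulVec, Finset.mul_sum]
    refine Finset.sum_congr rfl fun i _ => Finset.sum_congr rfl fun j _ => ?_
    simp only [Pi.star_apply]; ring
  have hint : ∀ i j, Integrable fun g : Fin m → ℂ => adjugate M i j * ((gw a g : ℂ) * (g j * star (g i))) :=
    fun i j => (gw_moment_int ha j i).const_mul _
  have h2 : ∀ i, (M + diagonal (Pi.single i 1)).det - M.det = adjugate M i i := by
    intro i
    have : (diagonal (Pi.single i 1) : Matrix (Fin m) (Fin m) ℂ) = vecMulVec (Pi.single i 1) (Pi.single i 1) := by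
      ext j k
      rw [diagonal_apply, vecMulVec_apply]
      by_cases hj : j = i
      · subst hj; by_cases hk : j = k
        · subst hk; simp
        · simp [hk, Ne.symm hk]
      · simp [hj]
    rw [this, det_rank_one]
    simp
  simp_rw [h1, h2]
  rw [integral_add, integral_finsetSum]
  · simp_rw [integral_finsetSum _ fun j _ => hint _ j, integral_const_mul, gw_moment ha]
    rw [integral_mul_const, integral_complex_ofReal, gw_integral ha, mul_add, Finset.mul_sum]
    congr 1
    refine Finset.sum_congr rfl fun i _ => ?_
    simp only [mul_ite, mul_zero, Finset.sum_ite_eq', Finset.mem_univ, if_true]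
    ring
  · exact fun i _ => integrable_finsetSum _ fun j _ => hint i j
  · exact ((gw_int ha).ofReal).mul_const _
  · exact integrable_finsetSum _ fun i _ => integrable_finsetSum _ fun j _ => hint i j

/-- Λ functional -/
noncomputable def Lam (n : ℕ) (P : Polynomial ℂ) : ℂ := P.sum fun k c => c * (n.descFactorial k : ℂ)

lemma Lam_eq (n : ℕ) (P : Polynomial ℂ) (N : ℕ) (h : P.natDegree < N) :
    Lam n P = ∑ k ∈ Finset.range N, P.coeff k * (n.descFactorial k : ℂ) :=
  Polynomial.sum_over_range' P (by simp) N h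

lemma Lam_add (n : ℕ) (P Q : Polynomial ℂ) : Lam n (P + Q) = Lam n P + Lam n Q :=
  Polynomial.sum_add_index P Q _ (by simp) (by intros; ring)

lemma Lam_C_mul (n : ℕ) (c : ℂ) (P : Polynomial ℂ) : Lam n (Polynomial.C c * P) = c * Lam n P := by
  have hd : (Polynomial.C c * P).natDegree ≤ P.natDegree := Polynomial.natDegree_C_mul_le c P
  rw [Lam_eq n _ (P.natDegree + 1) (by lia), Lam_eq n P (P.natDegree + 1) (by lia), Finset.mul_sum]
  simp [mul_assoc]

lemma Lam_sum {ι : Type*} (n : ℕ) (s : Finset ι) (f : ι → Polynomial ℂ) : Lam n (∑ i ∈ s, f i) = ∑ i ∈ s, Lam n (f i) := by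
  classical
  induction s using Finset.induction_on with
  | empty => simp [Lam]
  | insert a s ha ih => rw [Finset.sum_insert ha, Finset.sum_insert ha, Lam_add, ih]

lemma desc_succ (n k : ℕ) : (n + 1).descFactorial (k + 1) = n.descFactorial (k + 1) + (k + 1) * n.descFactorial k := by
  rw [Nat.succ_descFactorial_succ, Nat.descFactorial_succ]
  rcases le_or_gt k n with h | h
  · rw [← add_mul]; congr 1; lia
  · rw [Nat.descFactorial_of_lt h]; simp

lemma Lam_succ (n : ℕ) (P : Polynomial ℂ) : Lam (n + 1) P = Lam n P + Lam n P.derivative := by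
  have hd := Polynomial.natDegree_derivative_le P
  rw [Lam_eq (n+1) P (P.natDegree + 1 + 1) (by lia), Lam_eq n P (P.natDegree + 1 + 1) (by lia), Lam_eq n _ (P.natDegree + 1) (by lia),
   Finset.sum_range_succ', Finset.sum_range_succ' (fun k => P.coeff k * (n.descFactorial k : ℂ))]
  rw [add_right_comm, ← Finset.sum_add_distrib]
  simp only [Nat.descFactorial_zero]
  congr 1
  refine Finset.sum_congr rfl fun k _ => ?_
  rw [Polynomial.coeff_derivative, desc_succ]
  push_cast; ring

lemma Lam_zero (P : Polynomial ℂ) : Lam 0 P = P.coeff 0 := by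
  rw [Lam_eq 0 P (P.natDegree + 1) (by lia), Finset.sum_range_succ']
  simp

noncomputable def Pd {m : ℕ} (a : Fin m → ℝ) (d : Fin m → ℂ) : Polynomial ℂ :=
  ∏ i, (Polynomial.C (d i) + Polynomial.C ((1 / a i : ℝ) : ℂ) * Polynomial.X)

lemma Pd_deriv {m : ℕ} (a : Fin m → ℝ) (d : Fin m → ℂ) :
    (Pd a d).derivative = ∑ i, Polynomial.C ((1 / a i : ℝ) : ℂ) * (Pd a (d + Pi.single i 1) - Pd a d) := by
  unfold Pd
  rw [Polynomial.derivative_prod_finset]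
  refine Finset.sum_congr rfl fun i _ => ?_
  have key : ∀ e : Fin m → ℂ, ∏ j, (Polynomial.C (e j) + Polynomial.C ((1 / a j : ℝ) : ℂ) * Polynomial.X) =
      (Polynomial.C (e i) + Polynomial.C ((1 / a i : ℝ) : ℂ) * Polynomial.X) *
        ∏ j ∈ Finset.univ.erase i, (Polynomial.C (e j) + Polynomial.C ((1 / a j : ℝ) : ℂ) * Polynomial.X) :=
    fun e => (Finset.mul_prod_erase Finset.univ _ (Finset.mem_univ i)).symm
  rw [key, key]
  have : ∏ x ∈ Finset.univ.erase i, (Polynomial.C ((d + Pi.single i 1 : Fin m → ℂ) x) + Polynomial.C ((1 / a x : ℝ) : ℂ) * Polynomial.X)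
     = ∏ x ∈ Finset.univ.erase i, (Polynomial.C (d x) + Polynomial.C ((1 / a x : ℝ) : ℂ) * Polynomial.X) := by
    refine Finset.prod_congr rfl fun x hx => ?_
    rw [Pi.add_apply, Pi.single_eq_of_ne (Finset.ne_of_mem_erase hx), add_zero]
  rw [this]
  simp only [Pi.add_apply, Pi.single_eq_same, Polynomial.C_add, Polynomial.C_1, Polynomial.derivative_add, Polynomial.derivative_C, Polynomial.derivative_C_mul, Polynomial.derivative_X]
  ring

theorem J_lemma {m : ℕ} {a : Fin m → ℝ} (ha : ∀ i, 1 ≤ a i) (n : ℕ) : ∀ d : Fin m → ℂ,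
    ∫ x : Fin n → Fin m → ℂ, ((∏ l, gw a (x l) : ℝ) : ℂ) * (diagonal d + YY x).det =
      ((∏ k, Real.pi / a k : ℝ) : ℂ) ^ n * Lam n (Pd a d) := by
  have ha0 : ∀ i, 0 < a i := fun i => by linarith [ha i]
  induction n with
  | zero =>
    intro d
    rw [integral_unique]
    simp [YY, Lam_zero, Pd, Polynomial.coeff_zero_prod, measureReal_def, volume_pi]
  | succ n ih =>
    intro d
    have hmp := volume_preserving_piFinSuccAbove (fun _ : Fin (n+1) => Fin m → ℂ) 0
    have hcomp := hmp.symm.integral_comp' (g := fun x : Fin (n+1) → Fin m → ℂ => ((∏ l, gw a (x l) : ℝ) : ℂ) * (diagonal d + YY x).det)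
    rw [← hcomp]
    have hi : Integrable (fun p : (Fin m → ℂ) × (Fin n → Fin m → ℂ) => ((∏ l, gw a (((MeasurableEquiv.piFinSuccAbove (fun _ : Fin (n+1) => Fin m → ℂ) 0).symm p) l) : ℝ) : ℂ) * (diagonal d + YY ((MeasurableEquiv.piFinSuccAbove (fun _ : Fin (n+1) => Fin m → ℂ) 0).symm p)).det) := by
      exact (hmp.symm.integrable_comp_emb (MeasurableEquiv.measurableEmbedding _)).2 (gw_det_int ha (diagonal d))
    rw [Measure.volume_eq_prod] at hi ⊢
    rw [integral_prod_symm _ hi]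
    have hs : ∀ (g : Fin m → ℂ) (y : Fin n → Fin m → ℂ), ((∏ l, gw a (((MeasurableEquiv.piFinSuccAbove (fun _ : Fin (n+1) => Fin m → ℂ) 0).symm (g, y)) l) : ℝ) : ℂ) * (diagonal d + YY ((MeasurableEquiv.piFinSuccAbove (fun _ : Fin (n+1) => Fin m → ℂ) 0).symm (g, y))).det
      = ((∏ l, gw a (y l) : ℝ) : ℂ) * ((gw a g : ℂ) * ((diagonal d + YY y) + vecMulVec g (star g)).det) := by
      intro g y
      have e : (MeasurableEquiv.piFinSuccAbove (fun _ : Fin (n+1) => Fin m → ℂ) 0).symm (g, y) = Fin.cons g y := by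
        ext i
        simp [MeasurableEquiv.piFinSuccAbove]
      rw [e, Fin.prod_univ_succ]
      simp only [Fin.cons_zero, Fin.cons_succ, YY, Fin.sum_univ_succ]
      rw [show ∀ A B C : Matrix (Fin m) (Fin m) ℂ, A + (B + C) = A + C + B from fun A B C => by abel]
      push_cast; ring
    simp_rw [hs, integral_const_mul, one_col ha0]
    have hd : ∀ (y : Fin n → Fin m → ℂ) i, diagonal d + YY y + diagonal (Pi.single i 1) = diagonal (d + Pi.single i 1) + YY y := by
      intro y i
      rw [add_right_comm, diagonal_add]
      rfl
    simp_rw [hd]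
    have hexp : ∀ y : Fin n → Fin m → ℂ, ((∏ l, gw a (y l) : ℝ) : ℂ) * (((∏ k, Real.pi / a k : ℝ) : ℂ) * ((diagonal d + YY y).det + ∑ i, ((1 / a i : ℝ) : ℂ) * ((diagonal (d + Pi.single i 1) + YY y).det - (diagonal d + YY y).det)))
      = ((∏ k, Real.pi / a k : ℝ) : ℂ) * (((∏ l, gw a (y l) : ℝ) : ℂ) * (diagonal d + YY y).det + ∑ i, ((1 / a i : ℝ) : ℂ) * (((∏ l, gw a (y l) : ℝ) : ℂ) * (diagonal (d + Pi.single i 1) + YY y).det - ((∏ l, gw a (y l) : ℝ) : ℂ) * (diagonal d + YY y).det)) := by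
      intro y
      rw [mul_left_comm, mul_add, Finset.mul_sum]
      congr 2
      refine Finset.sum_congr rfl fun i _ => by ring
    simp_rw [hexp]
    rw [integral_const_mul, integral_add (gw_det_int ha _), integral_finsetSum]
    · simp_rw [integral_const_mul]
      simp_rw [integral_sub (gw_det_int ha _) (gw_det_int ha _), ih]
      rw [Lam_succ, Pd_deriv, Lam_sum, pow_succ]
      simp_rw [Lam_C_mul]
      have hsub : ∀ P Q : Polynomial ℂ, Lam n (P - Q) = Lam n P - Lam n Q := fun P Q => by
        rw [eq_sub_iff_add_eq, ← Lam_add, sub_add_cancel]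
      simp_rw [hsub]
      rw [mul_add, mul_add, Finset.mul_sum, Finset.mul_sum]
      congr 1
      · ring
      · refine Finset.sum_congr rfl fun i _ => by ring
    · exact fun i _ => ((gw_det_int ha _).sub (gw_det_int ha _)).const_mul _
    · exact integrable_finsetSum _ fun i _ => ((gw_det_int ha _).sub (gw_det_int ha _)).const_mul _

open ComplexOrder in
lemma YY_psd {n m : ℕ} (x : Fin n → Fin m → ℂ) : (YY x).PosSemidef := by
  unfold YY
  exact posSemidef_sum _ fun l _ => posSemidef_vecMulVec_self_star (x l)

lemma YY_herm {n m : ℕ} (x : Fin n → Fin m → ℂ) : (YY x).IsHermitian := (YY_psd x).1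

noncomputable def ev {n m : ℕ} (x : Fin n → Fin m → ℂ) : Fin m → ℝ := (YY_herm x).eigenvalues

lemma ev_nonneg {n m : ℕ} (x : Fin n → Fin m → ℂ) (i) : 0 ≤ ev x i := (YY_psd x).eigenvalues_nonneg i

lemma det_ev {n m : ℕ} (s : ℂ) (x : Fin n → Fin m → ℂ) :
    (diagonal (fun _ => s) + YY x).det = ∏ i, (s + ev x i) := by
  have h := (YY_herm x).charpoly_eq
  have h1 := congrArg (Polynomial.eval (-s)) h
  rw [eval_charpoly, Polynomial.eval_prod] at h1
  simp only [Polynomial.eval_sub, Polynomial.eval_X, Polynomial.eval_C] at h1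
  have e1 : diagonal (fun _ => s) + YY x = -(scalar (Fin m) (-s) - YY x) := by
    ext i j
    simp [scalar_apply, diagonal_apply]
    split_ifs <;> simp [add_comm]
  have e2 : ∏ i, (s + ev x i) = (-1) ^ m * ∏ i, (-s - ((ev x i : ℝ) : ℂ)) := by
    have : ((-1 : ℂ) ^ m) = ∏ i : Fin m, (-1 : ℂ) := by simp
    rw [this, ← Finset.prod_mul_distrib]
    exact Finset.prod_congr rfl fun i _ => by ring
  rw [e1, det_neg, h1, e2, Fintype.card_fin]
  rfl

noncomputable def Ds {n m : ℕ} (s : ℝ) (x : Fin n → Fin m → ℂ) : ℝ := ∏ i, (s + ev x i)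

lemma Ds_det {n m : ℕ} (s : ℝ) (x : Fin n → Fin m → ℂ) :
    ((Ds s x : ℝ) : ℂ) = (diagonal (fun _ => (s : ℂ)) + YY x).det := by
  rw [det_ev, Ds]; push_cast; rfl

lemma Ds_pos {n m : ℕ} {s : ℝ} (hs : 0 < s) (x : Fin n → Fin m → ℂ) : 0 < Ds s x :=
  Finset.prod_pos fun i _ => by linarith [ev_nonneg x i]

lemma Ds_cont {n m : ℕ} : Continuous fun p : ℝ × (Fin n → Fin m → ℂ) => Ds p.1 p.2 := by
  have : (fun p : ℝ × (Fin n → Fin m → ℂ) => Ds p.1 p.2) = fun p => ((diagonal (fun _ => (p.1 : ℂ)) + YY p.2).det).re := by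
    ext p; rw [← Ds_det, Complex.ofReal_re]
  rw [this]
  refine Complex.continuous_re.comp (Continuous.matrix_det (Continuous.add ?_ (YY_cont.comp continuous_snd)))
  exact Continuous.matrix_diagonal (by fun_prop)

lemma ev_sum {n m : ℕ} (x : Fin n → Fin m → ℂ) : ∑ i, ev x i = RR x := by
  have h := (YY_herm x).trace_eq_sum_eigenvalues
  have h2 : (YY x).trace = ((RR x : ℝ) : ℂ) := by
    unfold YY RR
    rw [trace_sum]
    push_cast
    refine Finset.sum_congr rfl fun l _ => ?_
    rw [trace_vecMulVec, sqn_dot, dotProduct_comm]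
  rw [h2] at h
  apply Complex.ofReal_injective
  rw [h, Complex.ofReal_sum]
  rfl

lemma quad_YY {n m : ℕ} (x : Fin n → Fin m → ℂ) (z : Fin m → ℂ) :
    star z ⬝ᵥ (YY x *ᵥ z) = ((∑ l, Complex.normSq (star (x l) ⬝ᵥ z) : ℝ) : ℂ) := by
  unfold YY
  rw [sum_mulVec, dotProduct_sum]
  push_cast
  refine Finset.sum_congr rfl fun l _ => ?_
  rw [vecMulVec_mulVec, Complex.normSq_eq_conj_mul_self]
  rw [dotProduct_smul]
  have : star z ⬝ᵥ x l = (starRingEnd ℂ) (star (x l) ⬝ᵥ z) := by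
    rw [starRingEnd_apply, star_dotProduct]
  rw [this, MulOpposite.smul_eq_mul_unop]
  rfl

lemma inv_det {n m : ℕ} {t : ℝ} (ht : 0 < t) (x : Fin n → Fin m → ℂ) :
    ∫ z : Fin m → ℂ, Real.exp (-(t * sqn z + ∑ l, Complex.normSq (star (x l) ⬝ᵥ z))) =
      Real.pi ^ m / Ds t x := by
  let U := (YY_herm x).eigenvectorUnitary
  have hU : (U : Matrix (Fin m) (Fin m) ℂ) ∈ unitaryGroup (Fin m) ℂ := U.2
  have hemb : MeasurableEmbedding (fun z : Fin m → ℂ => (U : Matrix (Fin m) (Fin m) ℂ) *ᵥ z) := by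
    refine (mulVec_cont _).measurableEmbedding ?_
    intro a b hab
    have := congrArg (fun w => star (U : Matrix (Fin m) (Fin m) ℂ) *ᵥ w) hab
    simpa [mulVec_mulVec, mem_unitaryGroup_iff'.1 hU] using this
  rw [← (vol_pres hU).integral_comp hemb]
  have key : ∀ z : Fin m → ℂ, Real.exp (-(t * sqn ((U : Matrix (Fin m) (Fin m) ℂ) *ᵥ z) + ∑ l, Complex.normSq (star (x l) ⬝ᵥ ((U : Matrix (Fin m) (Fin m) ℂ) *ᵥ z)))) = gw (fun i => t + ev x i) z := by
    intro z
    rw [gw_eq, sqn_unitary hU]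
    congr 2
    have h1 := quad_YY x ((U : Matrix (Fin m) (Fin m) ℂ) *ᵥ z)
    have h2 : star ((U : Matrix (Fin m) (Fin m) ℂ) *ᵥ z) ⬝ᵥ (YY x *ᵥ ((U : Matrix (Fin m) (Fin m) ℂ) *ᵥ z)) = ((∑ i, ev x i * Complex.normSq (z i) : ℝ) : ℂ) := by
      have hs := (YY_herm x).spectral_theorem
      rw [Unitary.conjStarAlgAut_apply] at hs
      have h3 : YY x *ᵥ ((U : Matrix (Fin m) (Fin m) ℂ) *ᵥ z) = (U : Matrix (Fin m) (Fin m) ℂ) *ᵥ (diagonal (fun i => ((ev x i : ℝ) : ℂ)) *ᵥ z) := by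
        rw [hs]
        rw [mulVec_mulVec, mulVec_mulVec, Matrix.mul_assoc]
        have : (star (U : Matrix (Fin m) (Fin m) ℂ)) * U = 1 := mem_unitaryGroup_iff'.1 hU
        change (_ * (star (U : Matrix (Fin m) (Fin m) ℂ) * (U : Matrix (Fin m) (Fin m) ℂ))) *ᵥ z = _
        rw [this, Matrix.mul_one]
        rfl
      rw [h3, unit_star_mulVec hU]
      simp only [dotProduct, mulVec_diagonal]
      push_cast
      refine Finset.sum_congr rfl fun i _ => ?_
      rw [Complex.normSq_eq_conj_mul_self, Pi.star_apply]
      simp only [starRingEnd_apply]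
      ring
    rw [h2] at h1
    rw [← Complex.ofReal_injective h1, sqn, Finset.mul_sum, ← Finset.sum_add_distrib]
    exact Finset.sum_congr rfl fun i _ => by ring
  simp_rw [key]
  rw [gw_integral fun i => by linarith [ev_nonneg x i], Finset.prod_div_distrib]
  simp [Ds]

lemma radial0 (p : ℕ) : ∃ c : ℝ, ∀ φ : ℝ → ℝ, ∫ z : Fin (p+1) → ℂ, φ (sqn z) =
    c * ∫ r in Set.Ioi (0:ℝ), r ^ p * φ r := by
  let E := EuclideanSpace ℂ (Fin (p+1))
  let : MeasurableSpace E := borel E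
  have : BorelSpace E := ⟨rfl⟩
  let e : (Fin (p+1) → ℂ) ≃L[ℝ] E := (PiLp.continuousLinearEquiv 2 ℝ (fun _ : Fin (p+1) => ℂ)).symm
  let μ : Measure E := Measure.map e volume
  have : μ.IsAddHaarMeasure := e.isAddHaarMeasure_map volume
  have hdim : Module.finrank ℝ E = 2 * (p + 1) := by
    rw [← e.toLinearEquiv.finrank_eq, Module.finrank_pi_fintype]
    simp [Complex.finrank_real_complex, mul_comm]
  have : Nontrivial E := by
    apply Module.nontrivial_of_finrank_pos (R := ℝ); rw [hdim]; lia
  refine ⟨(2 * (p + 1) : ℕ) * μ.real (Metric.ball 0 1) / 2, fun φ => ?_⟩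
  have h := integral_fun_norm_addHaar μ (fun y => φ (y ^ 2))
  have h1 : ∫ x, φ (‖x‖ ^ 2) ∂μ = ∫ z : Fin (p+1) → ℂ, φ (sqn z) := by
    have := integral_map_equiv (μ := (volume : Measure (Fin (p+1) → ℂ))) e.toHomeomorph.toMeasurableEquiv (fun x => φ (‖x‖ ^ 2))
    refine Eq.trans this ?_
    refine integral_congr_ae (Filter.Eventually.of_forall fun z => ?_)
    simp only
    rw [← sqn_norm]
    rfl
  rw [← h1, h, hdim]
  have h2 := integral_comp_rpow_Ioi_of_pos (g := fun r => r ^ p * φ r) (p := 2) (by norm_num)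
  rw [← h2, nsmul_eq_mul, smul_eq_mul, ← integral_const_mul, ← integral_const_mul, ← integral_const_mul]
  refine setIntegral_congr_fun measurableSet_Ioi fun y hy => ?_
  have hy : 0 < y := hy
  have e1 : 2 * (p + 1) - 1 = 2 * p + 1 := by lia
  simp only [smul_eq_mul, e1]
  norm_num
  rw [pow_succ, pow_mul]
  ring

lemma radial (p : ℕ) (φ : ℝ → ℝ) : ∫ z : Fin (p+1) → ℂ, φ (sqn z) =
    Real.pi ^ (p+1) / p.factorial * ∫ r in Set.Ioi (0:ℝ), r ^ p * φ r := by
  obtain ⟨c, hc⟩ := radial0 p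
  have h1 := hc (fun r => Real.exp (-r))
  have h2 : ∫ z : Fin (p+1) → ℂ, Real.exp (- sqn z) = Real.pi ^ (p+1) := by
    simp_rw [← gw_one]
    rw [gw_integral (by simp)]; simp
  have h3 : ∫ r in Set.Ioi (0:ℝ), r ^ p * Real.exp (-r) = p.factorial := by
    rw [← Real.Gamma_nat_eq_factorial, Real.Gamma_eq_integral (by positivity)]
    refine setIntegral_congr_fun measurableSet_Ioi fun y hy => ?_
    simp [mul_comm]
  rw [h2, h3] at h1
  rw [hc, h1]
  field_simp

noncomputable def qp (n p : ℕ) (b s : ℝ) : ℝ := ∑ k ∈ Finset.range (p+1), (p.choose k : ℝ) *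
  (s ^ (p + 1 - k) * n.descFactorial k + b * s ^ (p - k) * n.descFactorial (k+1))

lemma Lam_X_mul (n : ℕ) (c : ℂ) (k : ℕ) : Lam n (Polynomial.C c * Polynomial.X ^ k) = c * n.descFactorial k := by
  rw [Lam, Polynomial.C_mul_X_pow_eq_monomial, Polynomial.sum_monomial_index]
  simp

lemma Lam_qp (n p : ℕ) (r : ℝ) (s : ℝ) :
    Lam n (Pd (Fin.cons (1 + r) 1 : Fin (p+1) → ℝ) (fun _ => (s:ℂ))) = ((qp n p (1 / (1 + r)) s : ℝ) : ℂ) := by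
  unfold Pd
  rw [Fin.prod_univ_succ]
  simp only [Fin.cons_zero, Fin.cons_succ, Pi.one_apply, Finset.prod_const, Finset.card_univ, Fintype.card_fin, div_one, Complex.ofReal_one, Polynomial.C_1, one_mul]
  rw [add_comm (Polynomial.C (s:ℂ)) Polynomial.X, add_pow, Finset.mul_sum, Lam_sum, qp]
  rw [Complex.ofReal_sum]
  refine Finset.sum_congr rfl fun k hk => ?_
  have hk : k ≤ p := by simpa [Nat.lt_succ_iff] using hk
  have e : (Polynomial.C (s:ℂ) + Polynomial.C ((1 / (1 + r) : ℝ) : ℂ) * Polynomial.X) * (Polynomial.X ^ k * Polynomial.C (s:ℂ) ^ (p - k) * (p.choose k : Polynomial ℂ)) =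
    Polynomial.C ((p.choose k : ℂ) * s ^ (p + 1 - k)) * Polynomial.X ^ k + Polynomial.C ((p.choose k : ℂ) * ((1 / (1 + r) : ℝ) : ℂ) * s ^ (p - k)) * Polynomial.X ^ (k+1) := by
    have : p + 1 - k = p - k + 1 := by lia
    rw [this]
    simp only [Polynomial.C_mul, Polynomial.C_pow, pow_succ, map_natCast]
    ring
  rw [e, Lam_add, Lam_X_mul n, Lam_X_mul n]
  push_cast; ring

lemma unit_emb {ι : Type*} [Fintype ι] [DecidableEq ι] {U : Matrix ι ι ℂ}
    (hU : U ∈ unitaryGroup ι ℂ) : MeasurableEmbedding (fun v : ι → ℂ => U *ᵥ v) := by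
  refine (mulVec_cont _).measurableEmbedding ?_
  intro a b hab
  have := congrArg (fun w => star U *ᵥ w) hab
  simpa [mulVec_mulVec, mem_unitaryGroup_iff'.1 hU] using this

lemma YY_unit {n m : ℕ} {U : Matrix (Fin m) (Fin m) ℂ} (x : Fin n → Fin m → ℂ) :
    YY (fun l => U *ᵥ x l) = U * YY x * star U := by
  unfold YY
  rw [Finset.mul_sum, Finset.sum_mul]
  refine Finset.sum_congr rfl fun l _ => ?_
  rw [mul_vecMulVec, vecMulVec_mul, star_mulVec, star_eq_conjTranspose]

lemma Ds_unit {n m : ℕ} {U : Matrix (Fin m) (Fin m) ℂ} (hU : U ∈ unitaryGroup (Fin m) ℂ) (s : ℝ)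
    (x : Fin n → Fin m → ℂ) : Ds s (fun l => U *ᵥ x l) = Ds s x := by
  apply Complex.ofReal_injective
  rw [Ds_det, Ds_det, YY_unit]
  have : diagonal (fun _ => (s:ℂ)) + U * YY x * star U = U * (diagonal (fun _ => (s:ℂ)) + YY x) * star U := by
    rw [Matrix.mul_add, Matrix.add_mul]
    congr 1
    have e : diagonal (fun _ : Fin m => (s:ℂ)) = (s:ℂ) • (1 : Matrix (Fin m) (Fin m) ℂ) := by
      rw [smul_one_eq_diagonal]
    rw [e, Matrix.mul_smul, Matrix.mul_one, Matrix.smul_mul, mem_unitaryGroup_iff.1 hU]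
  rw [this, det_mul, det_mul, mul_right_comm, ← det_mul, mem_unitaryGroup_iff.1 hU, det_one, one_mul]

lemma G_formula (n p : ℕ) (s : ℝ) (z : Fin (p+1) → ℂ) :
    ∫ x : Fin n → Fin (p+1) → ℂ, Real.exp (-(RR x + ∑ l, Complex.normSq (star (x l) ⬝ᵥ z))) * Ds s x =
      (Real.pi ^ (p+1) / (1 + sqn z)) ^ n * qp n p (1 / (1 + sqn z)) s := by
  set r := sqn z with hr
  have hr0 : 0 ≤ r := sqn_nonneg z
  obtain ⟨U, hU, hUz⟩ : ∃ U ∈ unitaryGroup (Fin (p+1)) ℂ, U *ᵥ z = (Pi.single 0 ((√r : ℝ) : ℂ) : Fin (p+1) → ℂ) := by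
    rcases hr0.eq_or_lt with h0 | h0
    · refine ⟨1, one_mem _, ?_⟩
      rw [← h0]
      have : z = 0 := (sqn_eq_zero z).1 (by rw [← hr, ← h0])
      simp [this]
    · have hs : 0 < √r := Real.sqrt_pos.2 h0
      obtain ⟨U, hU, h⟩ := exists_unitary (((√r)⁻¹ : ℝ) • z : Fin (p+1) → ℂ) (Pi.single 0 1) (by
        have : (((√r)⁻¹ : ℝ) • z : Fin (p+1) → ℂ) = (((√r)⁻¹ : ℝ) : ℂ) • z := by ext i; simp
        rw [this, sqn_smul, Complex.normSq_ofReal, ← hr, ← mul_inv, Real.mul_self_sqrt hr0, inv_mul_cancel₀ h0.ne']) (by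
        unfold sqn
        rw [Finset.sum_eq_single 0] <;> simp +contextual)
      refine ⟨U, hU, ?_⟩
      have : z = (√r : ℝ) • ((√r)⁻¹ : ℝ) • z := by rw [smul_smul, mul_inv_cancel₀ hs.ne', one_smul]
      rw [this, mulVec_smul, h]
      ext i
      by_cases hi : i = 0
      · subst hi; simp
      · simp [hi]
  have hmp : MeasurePreserving (fun x : Fin n → Fin (p+1) → ℂ => fun l => U *ᵥ x l) volume volume :=
    volume_preserving_pi fun _ => vol_pres hU
  have hemb : MeasurableEmbedding (fun x : Fin n → Fin (p+1) → ℂ => fun l => U *ᵥ x l) := by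
    refine Continuous.measurableEmbedding ?_ ?_
    · exact continuous_pi fun l => (mulVec_cont U).comp (continuous_apply l)
    · intro a b hab
      ext1 l
      exact (unit_emb hU).injective (congrFun hab l)
  have h1 := hmp.integral_comp hemb (fun x => Real.exp (-(RR x + ∑ l, Complex.normSq (star (x l) ⬝ᵥ (U *ᵥ z)))) * Ds s x)
  simp_rw [unit_star_mulVec hU, Ds_unit hU, RR, sqn_unitary hU] at h1
  change ∫ x : Fin n → Fin (p+1) → ℂ, Real.exp (-(RR x + ∑ l, Complex.normSq (star (x l) ⬝ᵥ z))) * Ds s x = ∫ x : Fin n → Fin (p+1) → ℂ, Real.exp (-(RR x + ∑ l, Complex.normSq (star (x l) ⬝ᵥ (U *ᵥ z)))) * Ds s x at h1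
  rw [h1, hUz]
  have ha : ∀ i, 1 ≤ (Fin.cons (1 + r) 1 : Fin (p+1) → ℝ) i := by
    intro i
    refine Fin.cases ?_ (fun j => ?_) i
    · simpa using hr0
    · simp
  have hJ := J_lemma ha n (fun _ => (s:ℂ))
  rw [Lam_qp] at hJ
  simp_rw [← Ds_det, ← Complex.ofReal_mul] at hJ
  rw [integral_complex_ofReal, ← Complex.ofReal_pow, ← Complex.ofReal_mul] at hJ
  have hJ := Complex.ofReal_injective hJ
  have hpr : ∏ k : Fin (p+1), Real.pi / (Fin.cons (1 + r) 1 : Fin (p+1) → ℝ) k = Real.pi ^ (p+1) / (1 + r) := by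
    rw [Fin.prod_univ_succ]; simp [pow_succ]; ring
  rw [hpr] at hJ
  rw [← hJ]
  congr 1
  ext x
  congr 1
  simp only [gw_eq, ← Real.exp_sum]
  congr 1
  rw [RR, Finset.sum_neg_distrib, ← Finset.sum_add_distrib]
  congr 1
  refine Finset.sum_congr rfl fun l _ => ?_
  rw [sqn, Fin.sum_univ_succ, Fin.sum_univ_succ]
  simp only [Fin.cons_zero, Fin.cons_succ, Pi.one_apply, one_mul, dotProduct_single, Complex.normSq_mul, Complex.normSq_ofReal, Real.mul_self_sqrt hr0, Pi.star_apply]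
  rw [Complex.star_def, Complex.normSq_conj]
  ring

lemma Ds_bound {m : ℕ} (s : ℝ) : ∃ K : ℝ, 0 ≤ K ∧ ∀ (n : ℕ) (x : Fin n → Fin m → ℂ), |Ds s x| ≤ K * (1 + RR x) ^ m := by
  obtain ⟨K, hK0, hK⟩ := det_bound (diagonal (fun _ : Fin m => (s:ℂ)))
  refine ⟨K, hK0, fun n x => ?_⟩
  have := hK n x
  rwa [← Ds_det, Complex.norm_real] at this

lemma Ds_cont' {n m : ℕ} (s : ℝ) : Continuous fun x : Fin n → Fin m → ℂ => Ds s x :=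
  Ds_cont.comp (Continuous.prodMk_right s)

lemma Ds_int {n m : ℕ} (s : ℝ) : Integrable fun x : Fin n → Fin m → ℂ => Real.exp (-RR x) * Ds s x := by
  obtain ⟨K, hK0, hK⟩ := Ds_bound (m := m) s
  refine X_int (Continuous.aestronglyMeasurable ?_) K m fun x => ?_
  · exact (Real.continuous_exp.comp RR_cont.neg).mul (Ds_cont' s)
  · rw [norm_mul, Real.norm_of_nonneg (Real.exp_pos _).le, Real.norm_eq_abs]
    calc _ ≤ Real.exp (-RR x) * (K * (1 + RR x) ^ m) := by gcongr; exact hK n x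
      _ = _ := by ring

lemma F_formula (n p : ℕ) (s : ℝ) {t : ℝ} (ht : 0 < t) :
    ∫ x : Fin n → Fin (p+1) → ℂ, Real.exp (-RR x) * (Ds s x / Ds t x) =
      (Real.pi ^ (p+1)) ^ n / p.factorial * ∫ r in Set.Ioi (0:ℝ), r ^ p * (Real.exp (-(t * r)) * ((1 + r) ^ n)⁻¹ * qp n p (1 / (1 + r)) s) := by
  have hpi := Real.pi_pos
  have h1 : ∀ x : Fin n → Fin (p+1) → ℂ, Real.exp (-RR x) * (Ds s x / Ds t x) =
      (Real.pi ^ (p+1))⁻¹ * ∫ z : Fin (p+1) → ℂ, Real.exp (-RR x) * Ds s x * Real.exp (-(t * sqn z + ∑ l, Complex.normSq (star (x l) ⬝ᵥ z))) := by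
    intro x
    rw [integral_const_mul, inv_det ht]
    have := Ds_pos ht x
    field_simp
  simp_rw [h1]
  rw [integral_const_mul, integral_integral_swap]
  · have h2 : ∀ z : Fin (p+1) → ℂ, ∫ x : Fin n → Fin (p+1) → ℂ, Real.exp (-RR x) * Ds s x * Real.exp (-(t * sqn z + ∑ l, Complex.normSq (star (x l) ⬝ᵥ z)))
       = Real.exp (-(t * sqn z)) * ((Real.pi ^ (p+1) / (1 + sqn z)) ^ n * qp n p (1 / (1 + sqn z)) s) := by
      intro z
      rw [← G_formula, ← integral_const_mul]
      congr 1
      ext x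
      have : Real.exp (-RR x) * Real.exp (-(t * sqn z + ∑ l, Complex.normSq (star (x l) ⬝ᵥ z))) =
         Real.exp (-(t * sqn z)) * Real.exp (-(RR x + ∑ l, Complex.normSq (star (x l) ⬝ᵥ z))) := by
        rw [← Real.exp_add, ← Real.exp_add]; congr 1; ring
      linear_combination (Ds s x) * this
    simp_rw [h2]
    rw [radial p (fun r => Real.exp (-(t * r)) * ((Real.pi ^ (p+1) / (1 + r)) ^ n * qp n p (1 / (1 + r)) s))]
    rw [← mul_assoc, ← integral_const_mul, ← integral_const_mul]
    refine setIntegral_congr_fun measurableSet_Ioi fun r hr => ?_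
    rw [div_pow]
    field_simp
  · have hI := (Ds_int (n := n) (m := p+1) s).mul_prod ((gw_int (a := fun _ : Fin (p+1) => t) fun _ => ht))
    refine hI.mono (Continuous.aestronglyMeasurable ?_) (Filter.Eventually.of_forall ?_)
    · have c1 : Continuous fun q : (Fin n → Fin (p+1) → ℂ) × (Fin (p+1) → ℂ) => RR q.1 := RR_cont.comp continuous_fst
      have c2 : Continuous fun q : (Fin n → Fin (p+1) → ℂ) × (Fin (p+1) → ℂ) => Ds s q.1 := (Ds_cont' s).comp continuous_fst
      have c3 : Continuous fun q : (Fin n → Fin (p+1) → ℂ) × (Fin (p+1) → ℂ) => sqn q.2 := sqn_cont.comp continuous_snd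
      have c4 : Continuous fun q : (Fin n → Fin (p+1) → ℂ) × (Fin (p+1) → ℂ) => ∑ l, Complex.normSq (star (q.1 l) ⬝ᵥ q.2) := by
        refine continuous_finsetSum _ fun l _ => Complex.continuous_normSq.comp (Continuous.dotProduct ?_ continuous_snd)
        exact ((continuous_apply l).comp continuous_fst).star
      unfold Function.uncurry
      exact ((Real.continuous_exp.comp c1.neg).mul c2).mul (Real.continuous_exp.comp ((continuous_const.mul c3).add c4).neg)
    · rintro ⟨x, z⟩
      simp only [Function.uncurry]
      rw [norm_mul, norm_mul (Real.exp (-RR x) * Ds s x)]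
      refine mul_le_mul_of_nonneg_left ?_ (norm_nonneg _)
      rw [Real.norm_of_nonneg (Real.exp_pos _).le, Real.norm_of_nonneg (gw_nonneg _ _), gw_eq, ← Finset.mul_sum, Real.exp_le_exp, neg_le_neg_iff]
      have : 0 ≤ ∑ l, Complex.normSq (star (x l) ⬝ᵥ z) := Finset.sum_nonneg fun _ _ => Complex.normSq_nonneg _
      unfold sqn; linarith

open Polynomial in
noncomputable def wt (m j : ℕ) (t : ℝ) : ℝ :=
  m * (Lagrange.basis (Finset.range (m+1)) (fun j : ℕ => (j:ℝ)) j).eval t -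
    t * (derivative (Lagrange.basis (Finset.range (m+1)) (fun j : ℕ => (j:ℝ)) j)).eval t

lemma wt_cont (m j : ℕ) : Continuous (wt m j) := by
  unfold wt
  exact (continuous_const.mul (Polynomial.continuous _)).sub (continuous_id.mul (Polynomial.continuous _))

open Polynomial in
lemma wt_spec (m : ℕ) (P : ℝ[X]) (hP : P.natDegree ≤ m) (t : ℝ) :
    m * P.eval t - t * (derivative P).eval t = ∑ j ∈ Finset.range (m+1), wt m j t * P.eval (j:ℝ) := by
  have h := Lagrange.eq_interpolate (f := P) (s := Finset.range (m+1)) (v := fun j : ℕ => (j:ℝ))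
    (fun a _ b _ hab => Nat.cast_injective hab)
    (lt_of_le_of_lt degree_le_natDegree (by rw [Finset.card_range]; exact_mod_cast Nat.lt_succ_of_le hP))
  rw [Lagrange.interpolate_apply] at h
  have e1 : P.eval t = ∑ j ∈ Finset.range (m+1), P.eval (j:ℝ) * (Lagrange.basis (Finset.range (m+1)) (fun j : ℕ => (j:ℝ)) j).eval t := by
    conv_lhs => rw [h]
    simp [eval_finsetSum]
  have e2 : (derivative P).eval t = ∑ j ∈ Finset.range (m+1), P.eval (j:ℝ) * (derivative (Lagrange.basis (Finset.range (m+1)) (fun j : ℕ => (j:ℝ)) j)).eval t := by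
    conv_lhs => rw [h]
    simp [eval_finsetSum]
  rw [e1, e2, Finset.mul_sum, Finset.mul_sum, ← Finset.sum_sub_distrib]
  refine Finset.sum_congr rfl fun j _ => ?_
  unfold wt; ring

noncomputable def AA {n m : ℕ} (t : ℝ) (x : Fin n → Fin m → ℂ) : ℝ := ∑ i, ev x i / (t + ev x i)

open Polynomial in
lemma AA_poly {n m : ℕ} (x : Fin n → Fin m → ℂ) : ∃ P : ℝ[X], P.natDegree ≤ m ∧ (∀ s, P.eval s = Ds s x) ∧
    ∀ t, 0 < t → m * P.eval t - t * (derivative P).eval t = Ds t x * AA t x := by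
  refine ⟨∏ i, (X + C (ev x i)), ?_, ?_, ?_⟩
  · refine (natDegree_prod_le _ _).trans ?_
    simp
  · intro s; simp [eval_prod, Ds]
  · intro t ht
    rw [derivative_prod_finset]
    simp only [eval_prod, eval_finsetSum, derivative_add, derivative_X, derivative_C, eval_add, eval_X, eval_C, add_zero, mul_one]
    have h : (m:ℝ) * ∏ i, (t + ev x i) = ∑ j : Fin m, ∏ i, (t + ev x i) := by simp
    rw [h, Finset.mul_sum, ← Finset.sum_sub_distrib, AA, Finset.mul_sum]
    refine Finset.sum_congr rfl fun i _ => ?_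
    have hne : t + ev x i ≠ 0 := by linarith [ev_nonneg x i]
    rw [Ds, ← Finset.mul_prod_erase Finset.univ (fun i => t + ev x i) (Finset.mem_univ i)]
    field_simp
    ring

lemma AA_eq {n m : ℕ} (x : Fin n → Fin m → ℂ) {t : ℝ} (ht : 0 < t) :
    AA t x = ∑ j ∈ Finset.range (m+1), wt m j t * (Ds j x / Ds t x) := by
  obtain ⟨P, hd, he, hA⟩ := AA_poly x
  have h := hA t ht
  rw [wt_spec m P hd] at h
  simp_rw [he] at h
  have := Ds_pos ht x
  rw [← mul_right_inj' this.ne', ← h, Finset.mul_sum]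
  refine Finset.sum_congr rfl fun j _ => by field_simp

noncomputable def Qp (n p : ℕ) (b t : ℝ) : ℝ := ∑ k ∈ Finset.range (p+1), (p.choose k : ℝ) *
  (k * t ^ (p + 1 - k) * n.descFactorial k + b * (k + 1) * t ^ (p - k) * n.descFactorial (k+1))

open Polynomial in
lemma Qp_eq (n p : ℕ) (b t : ℝ) : Qp n p b t = ∑ j ∈ Finset.range (p+1+1), wt (p+1) j t * qp n p b j := by
  let P : ℝ[X] := ∑ k ∈ Finset.range (p+1), (C ((p.choose k : ℝ) * n.descFactorial k) * X ^ (p + 1 - k) + C ((p.choose k : ℝ) * b * n.descFactorial (k+1)) * X ^ (p - k))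
  have hd : P.natDegree ≤ p + 1 := by
    refine natDegree_sum_le_of_forall_le _ _ fun k _ => ?_
    refine natDegree_add_le_of_degree_le ?_ ?_
    · exact (natDegree_C_mul_X_pow_le _ _).trans (by lia)
    · exact (natDegree_C_mul_X_pow_le _ _).trans (by lia)
  have he : ∀ s, P.eval s = qp n p b s := by
    intro s
    simp only [P, eval_finsetSum, qp]
    refine Finset.sum_congr rfl fun k _ => ?_
    simp
    ring
  have h := wt_spec (p+1) P hd t
  simp_rw [he] at h
  rw [← h, ← he]
  simp only [P, eval_finsetSum, derivative_sum, Qp, Finset.mul_sum]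
  rw [← Finset.sum_sub_distrib]
  refine Finset.sum_congr rfl fun k hk => ?_
  have hk : k ≤ p := by simpa [Nat.lt_succ_iff] using hk
  obtain ⟨d, rfl⟩ := Nat.exists_eq_add_of_le hk
  have e1 : k + d + 1 - k = d + 1 := by lia
  have e2 : k + d - k = d := by lia
  rw [e1, e2]
  simp only [eval_add, eval_mul, eval_C, eval_pow, eval_X, derivative_add, derivative_mul, derivative_C, derivative_X_pow, zero_mul, zero_add, Nat.add_sub_cancel]
  rcases d with _ | d
  · simp; ring
  · simp only [Nat.add_sub_cancel]
    push_cast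
    ring

lemma base_int (p : ℕ) {t : ℝ} (ht : 0 < t) : IntegrableOn (fun r : ℝ => r ^ p * Real.exp (-(t * r))) (Set.Ioi 0) := by
  have hp : (0:ℝ) ≤ p := by positivity
  have := integrableOn_rpow_mul_exp_neg_mul_rpow (s := p) (p := 1) (b := t) (by linarith) zero_lt_one ht
  refine this.congr_fun (fun r hr => ?_) measurableSet_Ioi
  simp

lemma bdd_int (p : ℕ) {t : ℝ} (ht : 0 < t) {g : ℝ → ℝ} (hg : Measurable g) (K : ℝ) (hK : ∀ r, 0 < r → |g r| ≤ K) :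
    IntegrableOn (fun r : ℝ => r ^ p * (Real.exp (-(t * r)) * g r)) (Set.Ioi 0) := by
  have h := (base_int p ht).mul_bdd (c := K) hg.aestronglyMeasurable.restrict ((ae_restrict_iff' measurableSet_Ioi).2 (Filter.Eventually.of_forall hK))
  simp_rw [mul_assoc] at h
  exact h

lemma qp_meas (n p : ℕ) (s : ℝ) : Measurable fun r : ℝ => ((1 + r) ^ n)⁻¹ * qp n p (1 / (1 + r)) s := by
  unfold qp
  fun_prop

lemma qp_bdd (n p : ℕ) (s : ℝ) : ∃ K : ℝ, ∀ r, 0 < r → |((1 + r) ^ n)⁻¹ * qp n p (1 / (1 + r)) s| ≤ K := by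
  refine ⟨∑ k ∈ Finset.range (p+1), |(p.choose k : ℝ)| *
  (|s ^ (p + 1 - k) * n.descFactorial k| + |s ^ (p - k) * n.descFactorial (k+1)|), fun r hr => ?_⟩
  have h1 : |((1 + r) ^ n)⁻¹| ≤ 1 := by
    rw [abs_of_pos (by positivity)]
    exact inv_le_one_of_one_le₀ (one_le_pow₀ (by linarith))
  have h2 : |1 / (1 + r)| ≤ 1 := by
    rw [abs_of_pos (by positivity), div_le_one (by positivity)]; linarith
  rw [abs_mul]
  refine (mul_le_of_le_one_left (abs_nonneg _) h1).trans ?_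
  unfold qp
  refine (Finset.abs_sum_le_sum_abs _ _).trans (Finset.sum_le_sum fun k _ => ?_)
  rw [abs_mul]
  refine mul_le_mul_of_nonneg_left ?_ (abs_nonneg _)
  refine (abs_add_le _ _).trans ?_
  refine add_le_add le_rfl ?_
  rw [mul_assoc, abs_mul]
  exact mul_le_of_le_one_left (abs_nonneg _) h2

lemma Dq_int {n m : ℕ} (s : ℝ) {t : ℝ} (ht : 0 < t) : Integrable fun x : Fin n → Fin m → ℂ => Real.exp (-RR x) * (Ds s x / Ds t x) := by
  have hc : Continuous fun x : Fin n → Fin m → ℂ => (Ds t x)⁻¹ := (Ds_cont' t).inv₀ fun x => (Ds_pos ht x).ne'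
  have h := (Ds_int (n := n) (m := m) s).mul_bdd (c := (t ^ m)⁻¹) (g := fun x => (Ds t x)⁻¹) hc.aestronglyMeasurable (Filter.Eventually.of_forall fun x => by
    have := Ds_pos ht x
    rw [Real.norm_of_nonneg (by positivity)]
    have : t ^ m ≤ Ds t x := by
      have : t ^ m = ∏ i : Fin m, t := by simp
      rw [this, Ds]
      exact Finset.prod_le_prod (fun _ _ => ht.le) fun i _ => by linarith [ev_nonneg x i]
    gcongr)
  refine h.congr (Filter.Eventually.of_forall fun x => ?_)
  simp only [div_eq_mul_inv]; ring

lemma AA_int {n m : ℕ} {t : ℝ} (ht : 0 < t) : Integrable fun x : Fin n → Fin m → ℂ => Real.exp (-RR x) * AA t x := by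
  simp_rw [AA_eq _ ht, Finset.mul_sum]
  refine integrable_finsetSum _ fun j _ => ?_
  refine ((Dq_int (n := n) (m := m) j ht).const_mul (wt m j t)).congr (Filter.Eventually.of_forall fun x => ?_)
  simp only; ring

lemma AA_formula (n p : ℕ) {t : ℝ} (ht : 0 < t) :
    ∫ x : Fin n → Fin (p+1) → ℂ, Real.exp (-RR x) * AA t x =
      (Real.pi ^ (p+1)) ^ n / p.factorial * ∫ r in Set.Ioi (0:ℝ), r ^ p * (Real.exp (-(t * r)) * (((1 + r) ^ n)⁻¹ * Qp n p (1 / (1 + r)) t)) := by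
  have h1 : ∀ x : Fin n → Fin (p+1) → ℂ, Real.exp (-RR x) * AA t x = ∑ j ∈ Finset.range (p+1+1), wt (p+1) j t * (Real.exp (-RR x) * (Ds j x / Ds t x)) := by
    intro x
    rw [AA_eq x ht, Finset.mul_sum]
    exact Finset.sum_congr rfl fun j _ => by ring
  simp_rw [h1]
  rw [integral_finsetSum _ fun j _ => (Dq_int _ ht).const_mul _]
  simp_rw [integral_const_mul, F_formula n p _ ht]
  have h2 : ∀ r : ℝ, r ^ p * (Real.exp (-(t * r)) * (((1 + r) ^ n)⁻¹ * Qp n p (1 / (1 + r)) t)) =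
     ∑ j ∈ Finset.range (p+1+1), wt (p+1) j t * (r ^ p * (Real.exp (-(t * r)) * (((1 + r) ^ n)⁻¹ * qp n p (1 / (1 + r)) j))) := by
    intro r
    rw [Qp_eq, Finset.mul_sum, Finset.mul_sum, Finset.mul_sum]
    exact Finset.sum_congr rfl fun j _ => by ring
  simp_rw [h2]
  rw [integral_finsetSum]
  · simp_rw [integral_const_mul]
    rw [Finset.mul_sum]
    refine Finset.sum_congr rfl fun j _ => ?_
    simp_rw [mul_assoc]
    ring
  · intro j _
    obtain ⟨K, hK⟩ := qp_bdd n p j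
    exact (bdd_int p ht (qp_meas n p j) K hK).const_mul _

instance haarX (n m : ℕ) : (volume : Measure (Fin n → Fin m → ℂ)).IsAddHaarMeasure := by
  have : ∀ _ : Fin n, (volume : Measure (Fin m → ℂ)).IsAddHaarMeasure := fun _ => inferInstance
  exact Measure.pi.isAddHaarMeasure (fun _ : Fin n => (volume : Measure (Fin m → ℂ)))

lemma transfer {E F : Type*} [NormedAddCommGroup E] [NormedSpace ℝ E] [MeasureSpace E] [BorelSpace E]
    [FiniteDimensional ℝ E] [(volume : Measure E).IsAddHaarMeasure]
    [NormedAddCommGroup F] [NormedSpace ℝ F] [MeasureSpace F] [BorelSpace F]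
    [FiniteDimensional ℝ F] [(volume : Measure F).IsAddHaarMeasure] (e : E ≃L[ℝ] F) (w : F → ℝ)
    (hw : ∫ v, w (e v) = ∫ v, w v) (hw0 : ∫ v, w v ≠ 0) (φ : F → ℝ) : ∫ v, φ (e v) = ∫ v, φ v := by
  have : (Measure.map e (volume : Measure E)).IsAddHaarMeasure := e.isAddHaarMeasure_map volume
  have hc := Measure.isAddLeftInvariant_eq_smul (Measure.map e (volume : Measure E)) volume
  set c := (Measure.map e (volume : Measure E)).addHaarScalarFactor volume
  have key : ∀ φ : F → ℝ, ∫ v, φ (e v) = (c : ℝ) * ∫ v, φ v := by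
    intro φ
    have h := integral_map_equiv (μ := (volume : Measure E)) e.toHomeomorph.toMeasurableEquiv φ
    have h2 : ∫ y, φ y ∂(Measure.map e (volume : Measure E)) = ∫ v, φ (e v) := h
    rw [← h2, hc, integral_smul_nnreal_measure]
    rfl
  have h1 := key w
  rw [hw] at h1
  have hc1 : (c : ℝ) = 1 := by
    have : (c : ℝ) * ∫ v, w v = 1 * ∫ v, w v := by rw [← h1, one_mul]
    exact mul_right_cancel₀ hw0 this
  rw [key, hc1, one_mul]

lemma gauss_V {ι : Type*} [Fintype ι] : ∫ v : ι → ℂ, Real.exp (-sqn v) = Real.pi ^ Fintype.card ι := by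
  have : ∀ v : ι → ℂ, Real.exp (-sqn v) = ∏ i, Real.exp (-(1 * Complex.normSq (v i))) := by
    intro v; simp [sqn, ← Real.exp_sum]
  simp_rw [this]
  rw [integral_fintype_prod_volume_eq_prod (fun i (z : ℂ) => Real.exp (-(1 * Complex.normSq z)))]
  simp_rw [gint0 one_pos]
  simp

lemma gauss_X (n m : ℕ) : ∫ x : Fin n → Fin m → ℂ, Real.exp (-RR x) = (Real.pi ^ m) ^ n := by
  have : ∀ x : Fin n → Fin m → ℂ, Real.exp (-RR x) = ∏ i, Real.exp (-sqn (x i)) := by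
    intro v; simp [RR, ← Real.exp_sum]
  simp_rw [this]
  rw [integral_fintype_prod_volume_eq_prod (fun _ (z : Fin m → ℂ) => Real.exp (-sqn z))]
  simp [gauss_V]

def TT {m n : ℕ} (v : Fin m × Fin n → ℂ) : Fin n → Fin m → ℂ := fun l k => v (k, l)

lemma TT_RR {m n : ℕ} (v : Fin m × Fin n → ℂ) : RR (TT v) = sqn v := by
  simp only [RR, sqn, TT, Fintype.sum_prod_type]
  rw [Finset.sum_comm]

lemma TT_YY {m n : ℕ} (v : Fin m × Fin n → ℂ) : YY (TT v) = reducedDM v := by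
  ext i j
  simp only [YY, reducedDM, TT, Matrix.sum_apply, vecMulVec_apply]
  rfl

lemma TT_cont {m n : ℕ} : Continuous (TT : (Fin m × Fin n → ℂ) → _) := by
  unfold TT; fun_prop

noncomputable def TTe (m n : ℕ) : (Fin m × Fin n → ℂ) ≃L[ℝ] (Fin n → Fin m → ℂ) :=
  LinearEquiv.toContinuousLinearEquiv
  { toFun := TT
    invFun := fun x k => x k.2 k.1
    map_add' := fun _ _ => rfl
    map_smul' := fun _ _ => rfl
    left_inv := fun _ => rfl
    right_inv := fun _ => rfl }

lemma trans_TT {m n : ℕ} (φ : (Fin n → Fin m → ℂ) → ℝ) : ∫ v : Fin m × Fin n → ℂ, φ (TT v) = ∫ x, φ x := by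
  refine transfer (TTe m n) (fun x => Real.exp (-RR x)) ?_ ?_ φ
  · change ∫ v : Fin m × Fin n → ℂ, Real.exp (-RR (TT v)) = _
    simp_rw [TT_RR]
    rw [gauss_V, gauss_X, ← pow_mul]
    simp
  · rw [gauss_X]; have := Real.pi_pos; positivity

noncomputable def SS {m n : ℕ} (v : Fin m × Fin n → ℂ) : Fin (m * n) → Fin 1 → ℂ := fun l _ => v (finProdFinEquiv.symm l)

lemma SS_RR {m n : ℕ} (v : Fin m × Fin n → ℂ) : RR (SS v) = sqn v := by
  simp only [RR, sqn, SS, Fin.sum_univ_one]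
  exact Equiv.sum_comp finProdFinEquiv.symm (fun i => Complex.normSq (v i))

noncomputable def SSe (m n : ℕ) : (Fin m × Fin n → ℂ) ≃L[ℝ] (Fin (m * n) → Fin 1 → ℂ) :=
  LinearEquiv.toContinuousLinearEquiv
  { toFun := SS
    invFun := fun x k => x (finProdFinEquiv k) 0
    map_add' := fun _ _ => rfl
    map_smul' := fun _ _ => rfl
    left_inv := fun v => by ext i; simp [SS]
    right_inv := fun x => by
      ext i j
      change x (finProdFinEquiv (finProdFinEquiv.symm i)) 0 = x i j
      rw [Equiv.apply_symm_apply, Subsingleton.elim j 0] }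

lemma trans_SS {m n : ℕ} (φ : (Fin (m * n) → Fin 1 → ℂ) → ℝ) : ∫ v : Fin m × Fin n → ℂ, φ (SS v) = ∫ x, φ x := by
  refine transfer (SSe m n) (fun x => Real.exp (-RR x)) ?_ ?_ φ
  · change ∫ v : Fin m × Fin n → ℂ, Real.exp (-RR (SS v)) = _
    simp_rw [SS_RR]
    rw [gauss_V, gauss_X, ← pow_mul]
    simp
  · rw [gauss_X]; have := Real.pi_pos; positivity

lemma ev_one {n : ℕ} (x : Fin n → Fin 1 → ℂ) : ev x 0 = RR x := by
  rw [← ev_sum]; simp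

lemma Z_V (m n : ℕ) : ∫ v : Fin m × Fin n → ℂ, Real.exp (-sqn v) * sqn v = (m * n : ℕ) * Real.pi ^ (m * n) := by
  have h := trans_SS (m := m) (n := n) (fun x => Real.exp (-RR x) * RR x)
  simp_rw [SS_RR] at h
  rw [h]
  have hJ := G_formula (m * n) 0 0 0
  simp only [dotProduct_zero, Complex.normSq_zero, Finset.sum_const_zero, add_zero] at hJ
  have e : ∀ x : Fin (m * n) → Fin (0+1) → ℂ, Ds 0 x = RR x := fun x => by simp [Ds, ev_one]
  simp_rw [e] at hJ
  rw [hJ]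
  simp [qp, sqn, mul_comm]

lemma Q1_V (m n : ℕ) {t : ℝ} (ht : 0 < t) : ∫ v : Fin m × Fin n → ℂ, Real.exp (-sqn v) * (sqn v / (t + sqn v)) =
    Real.pi ^ (m * n) * ∫ r in Set.Ioi (0:ℝ), Real.exp (-(t * r)) * ((m * n : ℕ) * ((1 + r) ^ (m * n + 1))⁻¹) := by
  have h := trans_SS (m := m) (n := n) (fun x => Real.exp (-RR x) * (RR x / (t + RR x)))
  simp_rw [SS_RR] at h
  rw [h]
  have hA := AA_formula (m * n) 0 ht
  have e : ∀ x : Fin (m * n) → Fin (0+1) → ℂ, AA t x = RR x / (t + RR x) := fun x => by simp [AA, ev_one]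
  simp_rw [e] at hA
  rw [hA]
  simp only [Nat.factorial_zero, Nat.cast_one, div_one, zero_add, pow_one]
  congr 1
  refine setIntegral_congr_fun measurableSet_Ioi fun r hr => ?_
  have hr : 0 < r := hr
  simp [Qp]
  field_simp
  ring

lemma AA_V (p n : ℕ) {t : ℝ} (ht : 0 < t) : ∫ v : Fin (p+1) × Fin n → ℂ, Real.exp (-sqn v) * AA t (TT v) =
   Real.pi ^ ((p+1) * n) / p.factorial * ∫ r in Set.Ioi (0:ℝ), r ^ p * (Real.exp (-(t * r)) * (((1 + r) ^ n)⁻¹ * Qp n p (1 / (1 + r)) t)) := by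
  have h := trans_TT (m := p+1) (n := n) (fun x => Real.exp (-RR x) * AA t x)
  simp_rw [TT_RR] at h
  rw [h, AA_formula n p ht, pow_mul]

lemma swap_nonneg {α β : Type*} [MeasurableSpace α] [MeasurableSpace β] (μ : Measure α) (ν : Measure β)
    [SFinite μ] [SFinite ν] (f : α → β → ℝ) (hf : Measurable (Function.uncurry f))
    (h0 : ∀ᵐ a ∂μ, ∀ᵐ b ∂ν, 0 ≤ f a b) (h0' : ∀ᵐ b ∂ν, ∀ᵐ a ∂μ, 0 ≤ f a b)
    (h1 : ∀ᵐ a ∂μ, Integrable (f a) ν) (h2 : ∀ᵐ b ∂ν, Integrable (fun a => f a b) μ) :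
    ∫ a, ∫ b, f a b ∂ν ∂μ = ∫ b, ∫ a, f a b ∂μ ∂ν := by
  rw [integral_eq_lintegral_of_nonneg_ae, integral_eq_lintegral_of_nonneg_ae]
  · congr 1
    have e1 : ∫⁻ a, ENNReal.ofReal (∫ b, f a b ∂ν) ∂μ = ∫⁻ a, ∫⁻ b, ENNReal.ofReal (f a b) ∂ν ∂μ := by
      refine lintegral_congr_ae ?_
      filter_upwards [h0, h1] with a ha hb
      exact ofReal_integral_eq_lintegral_ofReal hb ha
    have e2 : ∫⁻ b, ENNReal.ofReal (∫ a, f a b ∂μ) ∂ν = ∫⁻ b, ∫⁻ a, ENNReal.ofReal (f a b) ∂μ ∂ν := by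
      refine lintegral_congr_ae ?_
      filter_upwards [h0', h2] with a ha hb
      exact ofReal_integral_eq_lintegral_ofReal hb ha
    rw [e1, e2]
    exact lintegral_lintegral_swap (f := fun a b => ENNReal.ofReal (f a b)) (ENNReal.measurable_ofReal.comp hf).aemeasurable
  · filter_upwards [h0'] with b hb using integral_nonneg_of_ae hb
  · exact hf.stronglyMeasurable.integral_prod_left.aestronglyMeasurable
  · filter_upwards [h0] with b hb using integral_nonneg_of_ae hb
  · exact hf.stronglyMeasurable.integral_prod_right.aestronglyMeasurable

lemma ent_int {l R : ℝ} (hl : 0 ≤ l) (hR : l ≤ R) (hR0 : 0 < R) :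
    IntegrableOn (fun t : ℝ => l / (t + l) - l / (t + R)) (Set.Ioi 0) ∧
    ∫ t in Set.Ioi (0:ℝ), (l / (t + l) - l / (t + R)) = l * (Real.log R - Real.log l) := by
  rcases hl.eq_or_lt with rfl | hl
  · simp
  have hd : ∀ t ∈ Set.Ici (0:ℝ), HasDerivAt (fun t => l * (Real.log (t + l) - Real.log (t + R))) (l / (t + l) - l / (t + R)) t := by
    intro t ht
    have ht : 0 ≤ t := ht
    have h1 := ((hasDerivAt_id t).add_const l).log (by simp; positivity)
    have h2 := ((hasDerivAt_id t).add_const R).log (by simp; positivity)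
    have := (h1.sub h2).const_mul l
    refine HasDerivAt.congr_deriv this ?_
    simp only [id]
    ring
  have hp : ∀ t ∈ Set.Ioi (0:ℝ), 0 ≤ l / (t + l) - l / (t + R) := by
    intro t ht
    have ht : 0 < t := ht
    rw [sub_nonneg]
    gcongr
  have hlim : Filter.Tendsto (fun t : ℝ => l * (Real.log (t + l) - Real.log (t + R))) Filter.atTop (nhds 0) := by
    have h1 : Filter.Tendsto (fun t : ℝ => Real.log (1 - (R - l) / (t + R))) Filter.atTop (nhds (Real.log (1 - 0))) := by
      refine Filter.Tendsto.log ?_ (by norm_num)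
      refine tendsto_const_nhds.sub ?_
      exact Filter.Tendsto.div_atTop tendsto_const_nhds (Filter.tendsto_atTop_add_const_right _ _ Filter.tendsto_id)
    have h2 := h1.const_mul l
    simp only [sub_zero, Real.log_one, mul_zero] at h2
    refine h2.congr' ?_
    filter_upwards [Filter.eventually_gt_atTop 0] with t ht
    rw [← Real.log_div (by positivity) (by positivity)]
    congr 2
    field_simp
    ring
  refine ⟨integrableOn_Ioi_deriv_of_nonneg' hd hp hlim, ?_⟩
  rw [integral_Ioi_of_hasDerivAt_of_nonneg' hd hp hlim]
  simp
  ring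

noncomputable def qq {n m : ℕ} (t : ℝ) (x : Fin n → Fin m → ℂ) : ℝ := AA t x - RR x / (t + RR x)

lemma qq_eq {n m : ℕ} (t : ℝ) (x : Fin n → Fin m → ℂ) : qq t x = ∑ i, (ev x i / (t + ev x i) - ev x i / (t + RR x)) := by
  rw [qq, AA, Finset.sum_sub_distrib, ← Finset.sum_div, ev_sum]

lemma ev_le {n m : ℕ} (x : Fin n → Fin m → ℂ) (i) : ev x i ≤ RR x := by
  rw [← ev_sum]
  exact Finset.single_le_sum (fun i _ => ev_nonneg x i) (Finset.mem_univ i)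

lemma qq_nonneg {n m : ℕ} {t : ℝ} (ht : 0 < t) (x : Fin n → Fin m → ℂ) : 0 ≤ qq t x := by
  rw [qq_eq]
  refine Finset.sum_nonneg fun i _ => ?_
  have := ev_nonneg x i
  have := ev_le x i
  rw [sub_nonneg]
  gcongr

lemma qq_int {n m : ℕ} (x : Fin n → Fin m → ℂ) : IntegrableOn (fun t => qq t x) (Set.Ioi 0) := by
  simp_rw [qq_eq]
  refine integrable_finsetSum _ fun i _ => ?_
  rcases (RR_nonneg x).eq_or_lt with h | h
  · have : ev x i = 0 := le_antisymm (h ▸ ev_le x i) (ev_nonneg x i)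
    simp [this]
  · exact (ent_int (ev_nonneg x i) (ev_le x i) h).1

lemma qq_ent {n m : ℕ} (x : Fin n → Fin m → ℂ) (hR : RR x = 1) : ∫ t in Set.Ioi (0:ℝ), qq t x = vnEntropy (YY x) := by
  rw [vnEntropy, dif_pos (YY_herm x)]
  simp_rw [qq_eq]
  have hi := fun i => ent_int (ev_nonneg x i) (ev_le x i) (by rw [hR]; norm_num)
  rw [integral_finsetSum _ fun i _ => (hi i).1]
  refine Finset.sum_congr rfl fun i _ => ?_
  rw [(hi i).2, hR, Real.negMulLog]
  simp [ev]

lemma YY_scale {n m : ℕ} (c : ℝ) (x : Fin n → Fin m → ℂ) : YY (c • x) = ((c^2 : ℝ) : ℂ) • YY x := by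
  ext i j
  simp only [YY, Matrix.sum_apply, vecMulVec_apply, Matrix.smul_apply, Pi.smul_apply, Pi.star_apply, smul_eq_mul, Finset.mul_sum]
  refine Finset.sum_congr rfl fun l _ => ?_
  simp
  ring

lemma RR_scale {n m : ℕ} (c : ℝ) (x : Fin n → Fin m → ℂ) : RR (c • x) = c ^ 2 * RR x := by
  simp only [RR, sqn, Finset.mul_sum, Pi.smul_apply, Complex.real_smul, Complex.normSq_mul, Complex.normSq_ofReal]
  simp_rw [sq]

lemma Ds_scale {n m : ℕ} {c : ℝ} (hc : 0 < c) (s : ℝ) (x : Fin n → Fin m → ℂ) :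
    Ds s (c • x) = (c ^ 2) ^ m * Ds (s / c ^ 2) x := by
  apply Complex.ofReal_injective
  rw [Ds_det, Complex.ofReal_mul, Ds_det, YY_scale]
  have : (diagonal (fun _ : Fin m => (s : ℂ)) + ((c^2 : ℝ) : ℂ) • YY x) = ((c^2 : ℝ) : ℂ) • (diagonal (fun _ => ((s / c ^ 2 : ℝ) : ℂ)) + YY x) := by
    rw [smul_add]
    congr 1
    ext i j
    have : (c : ℂ) ≠ 0 := by exact_mod_cast hc.ne'
    by_cases h : i = j
    · subst h; simp; field_simp
    · simp [h]
  rw [this, det_smul]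
  simp

lemma Ds_log {n m : ℕ} {t : ℝ} (ht : 0 < t) (x : Fin n → Fin m → ℂ) :
    HasDerivAt (fun s => Real.log (Ds s x)) ((m - AA t x) / t) t := by
  obtain ⟨P, -, he, hA⟩ := AA_poly x
  have h := (P.hasDerivAt t).log (by rw [he]; exact (Ds_pos ht x).ne')
  simp only [he] at h
  convert h using 1
  have := hA t ht
  rw [he] at this
  have hp := Ds_pos ht x
  field_simp
  linarith

lemma AA_scale {n m : ℕ} {c t : ℝ} (hc : 0 < c) (ht : 0 < t) (x : Fin n → Fin m → ℂ) : AA t (c • x) = AA (t / c ^ 2) x := by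
  have h1 := Ds_log ht (c • x)
  have h2 := Ds_log (t := t / c ^ 2) (by positivity) x
  have h3 : HasDerivAt (fun s => s / c ^ 2) (1 / c ^ 2) t := (hasDerivAt_id t).div_const _
  have h4 := (h2.comp t h3).const_add (Real.log ((c ^ 2) ^ m))
  have h5 : (fun s => Real.log (Ds s (c • x))) =ᶠ[nhds t] fun s => Real.log ((c ^ 2) ^ m) + ((fun s => Real.log (Ds s x)) ∘ (fun s => s / c ^ 2)) s := by
    filter_upwards [eventually_gt_nhds ht] with s hs
    have := Ds_pos (s := s / c ^ 2) (by positivity) x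
    rw [Ds_scale hc, Real.log_mul (by positivity) this.ne']
    rfl
  have h6 := h1.unique (h4.congr_of_eventuallyEq h5)
  field_simp at h6
  linarith

lemma qq_scale {n m : ℕ} {c t : ℝ} (hc : 0 < c) (ht : 0 < t) (x : Fin n → Fin m → ℂ) : qq t (c • x) = qq (t / c ^ 2) x := by
  rw [qq, qq, AA_scale hc ht, RR_scale]
  congr 1
  have := RR_nonneg x
  field_simp

noncomputable def qM {n m : ℕ} (x : Fin n → Fin m → ℂ) (t : ℝ) : ℝ :=
  ∑ j ∈ Finset.range (m+1), wt m j t * (Ds j x / Ds t x) - RR x / (t + RR x)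

lemma qM_eq {n m : ℕ} (x : Fin n → Fin m → ℂ) {t : ℝ} (ht : 0 < t) : qM x t = qq t x := by
  rw [qM, qq, AA_eq x ht]

lemma qM_meas {n m : ℕ} : Measurable (Function.uncurry (qM : (Fin n → Fin m → ℂ) → ℝ → ℝ)) := by
  unfold Function.uncurry qM
  have h1 : ∀ j, Measurable (wt m j) := fun j => (wt_cont m j).measurable
  have h2 : Measurable fun p : (Fin n → Fin m → ℂ) × ℝ => Ds p.2 p.1 := (Ds_cont.comp continuous_swap).measurable
  have h3 : ∀ s : ℝ, Measurable fun x : (Fin n → Fin m → ℂ) => Ds s x := fun s => (Ds_cont' s).measurable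
  have h4 : Measurable (RR : (Fin n → Fin m → ℂ) → ℝ) := RR_cont.measurable
  refine Measurable.sub (Finset.measurable_sum _ fun j _ => ?_) ?_
  · exact ((h1 j).comp measurable_snd).mul (((h3 j).comp measurable_fst).div h2)
  · exact (h4.comp measurable_fst).div (measurable_snd.add (h4.comp measurable_fst))

lemma qMT_meas {m n : ℕ} : Measurable (Function.uncurry fun (v : Fin m × Fin n → ℂ) (t : ℝ) => qM (TT v) t) := by
  have h1 : Measurable (TT : (Fin m × Fin n → ℂ) → _) := TT_cont.measurable
  have h2 : Measurable fun p : (Fin m × Fin n → ℂ) × ℝ => (TT p.1, p.2) := (h1.comp measurable_fst).prodMk measurable_snd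
  have h3 : (Function.uncurry fun (v : Fin m × Fin n → ℂ) (t : ℝ) => qM (TT v) t) = (Function.uncurry (qM : (Fin n → Fin m → ℂ) → ℝ → ℝ)) ∘ (fun p : (Fin m × Fin n → ℂ) × ℝ => (TT p.1, p.2)) := by
    ext1 p; rfl
  rw [h3]
  exact Measurable.comp qM_meas h2

noncomputable def HH {m n : ℕ} (v : Fin m × Fin n → ℂ) : ℝ := ∫ t in Set.Ioi (0:ℝ), qq t (TT v)

lemma HH_eq {m n : ℕ} (v : Fin m × Fin n → ℂ) : HH v = ∫ t in Set.Ioi (0:ℝ), qM (TT v) t :=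
  setIntegral_congr_fun measurableSet_Ioi fun t ht => (qM_eq _ ht).symm

lemma HH_meas {m n : ℕ} : StronglyMeasurable (HH : (Fin m × Fin n → ℂ) → ℝ) := by
  have : (HH : (Fin m × Fin n → ℂ) → ℝ) = fun v => ∫ t in Set.Ioi (0:ℝ), qM (TT v) t := funext HH_eq
  rw [this]
  exact qMT_meas.stronglyMeasurable.integral_prod_right

lemma HH_ent {m n : ℕ} (v : Fin m × Fin n → ℂ) (hv : sqn v = 1) : vnEntropy (reducedDM v) = HH v := by
  rw [← TT_YY, ← qq_ent _ (by rw [TT_RR, hv]), HH]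

lemma HH_scale {m n : ℕ} {c : ℝ} (hc : 0 < c) (v : Fin m × Fin n → ℂ) : HH (c • v) = c ^ 2 * HH v := by
  have h : HH (c • v) = ∫ t in Set.Ioi (0:ℝ), qq ((c^2)⁻¹ * t) (TT v) := by
    refine setIntegral_congr_fun measurableSet_Ioi fun t ht => ?_
    have : TT (c • v) = c • TT v := rfl
    simp only [this]
    rw [qq_scale hc ht, div_eq_inv_mul]
  rw [h, integral_comp_mul_left_Ioi (fun t => qq t (TT v)) 0 (by positivity)]
  simp [HH]

noncomputable def nrm {ι : Type*} [Fintype ι] (v : ι → ℂ) : ι → ℂ := (√(sqn v))⁻¹ • v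

lemma nrm_meas {ι : Type*} [Fintype ι] : Measurable (nrm : (ι → ℂ) → ι → ℂ) := by
  have h : Measurable (sqn : (ι → ℂ) → ℝ) := sqn_cont.measurable
  have h2 : Measurable fun v : ι → ℂ => (√(sqn v))⁻¹ := (Real.continuous_sqrt.measurable.comp h).inv
  exact h2.smul measurable_id

lemma sqn_smul_real {ι : Type*} [Fintype ι] (c : ℝ) (v : ι → ℂ) : sqn (c • v) = c ^ 2 * sqn v := by
  have := sqn_smul (c : ℂ) v
  rw [Complex.normSq_ofReal, ← sq] at this
  rw [← this]
  congr 1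

lemma nrm_sqn {ι : Type*} [Fintype ι] {v : ι → ℂ} (hv : v ≠ 0) : sqn (nrm v) = 1 := by
  have h : sqn v ≠ 0 := fun h => hv ((sqn_eq_zero v).1 h)
  rw [nrm, sqn_smul_real, inv_pow, Real.sq_sqrt (sqn_nonneg v), inv_mul_cancel₀ h]

lemma nrm_unit {ι : Type*} [Fintype ι] [DecidableEq ι] {U : Matrix ι ι ℂ}
    (hU : U ∈ unitaryGroup ι ℂ) (v : ι → ℂ) : nrm (U *ᵥ v) = U *ᵥ nrm v := by
  rw [nrm, nrm, sqn_unitary hU, mulVec_smul]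

lemma HH_nrm {m n : ℕ} (v : Fin m × Fin n → ℂ) (hv : v ≠ 0) : sqn v * HH (nrm v) = HH v := by
  have h : 0 < sqn v := lt_of_le_of_ne (sqn_nonneg v) fun h => hv ((sqn_eq_zero v).1 h.symm)
  rw [nrm, HH_scale (by positivity), inv_pow, Real.sq_sqrt h.le]
  field_simp

noncomputable def dens {m n : ℕ} (v : Fin m × Fin n → ℂ) : ℝ :=
  Real.exp (-sqn v) * sqn v / ((m * n : ℕ) * Real.pi ^ (m * n))

lemma dens_nonneg {m n : ℕ} (v : Fin m × Fin n → ℂ) : 0 ≤ dens v := by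
  have := sqn_nonneg v
  have := Real.pi_pos
  unfold dens; positivity

lemma dens_meas {m n : ℕ} : Measurable (dens : (Fin m × Fin n → ℂ) → ℝ) := by
  have h : Continuous (sqn : (Fin m × Fin n → ℂ) → ℝ) := sqn_cont
  unfold dens
  exact Continuous.measurable (by fun_prop)

noncomputable def rho (m n : ℕ) : Measure (Fin m × Fin n → ℂ) := volume.withDensity fun v => ENNReal.ofReal (dens v)

lemma rho_prob {m n : ℕ} (hN : 0 < m * n) : IsProbabilityMeasure (rho m n) := by
  constructor
  have h1 : ∫ v : Fin m × Fin n → ℂ, dens v = 1 := by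
    unfold dens
    rw [integral_div, Z_V, div_self]
    have := Real.pi_pos
    have : (0:ℝ) < (m * n : ℕ) := by exact_mod_cast hN
    positivity
  have h2 : Integrable (dens : (Fin m × Fin n → ℂ) → ℝ) := by
    by_contra h
    rw [integral_undef h] at h1
    exact zero_ne_one h1
  rw [rho, withDensity_apply _ MeasurableSet.univ, Measure.restrict_univ,
    ← ofReal_integral_eq_lintegral_ofReal h2 (Filter.Eventually.of_forall dens_nonneg), h1, ENNReal.ofReal_one]

lemma rho_unit {m n : ℕ} {U : Matrix (Fin m × Fin n) (Fin m × Fin n) ℂ} (hU : U ∈ unitaryGroup (Fin m × Fin n) ℂ) :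
    (rho m n).map (fun v => U *ᵥ v) = rho m n := by
  ext s hs
  rw [Measure.map_apply (mulVec_cont U).measurable hs, rho, withDensity_apply _ hs, withDensity_apply _ ((mulVec_cont U).measurable hs)]
  have h := (vol_pres hU).setLIntegral_comp_preimage_emb (unit_emb hU) (fun v => ENNReal.ofReal (dens v)) s
  rw [← h]
  simp [dens, sqn_unitary hU]

lemma ae_ne_zero {m n : ℕ} (hN : 0 < m * n) : ∀ᵐ v : Fin m × Fin n → ℂ, v ≠ 0 := by
  have hm : 0 < m := Nat.pos_of_mul_pos_right hN
  have hn : 0 < n := Nat.pos_of_mul_pos_left hN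
  have : Nonempty (Fin m × Fin n) := ⟨(⟨0, hm⟩, ⟨0, hn⟩)⟩
  rw [ae_iff]
  simp

lemma red1 {m n : ℕ} (hN : 0 < m * n) (μ : Measure (Fin m × Fin n → ℂ)) [IsProbabilityMeasure μ]
    (h1 : ∀ᵐ ψ ∂μ, sqn ψ = 1) (h2 : ∀ U ∈ Matrix.unitaryGroup (Fin m × Fin n) ℂ, μ.map (fun ψ => U *ᵥ ψ) = μ) :
    ∫ ψ, vnEntropy (reducedDM ψ) ∂μ = (∫ v : Fin m × Fin n → ℂ, Real.exp (-sqn v) * HH v) / ((m * n : ℕ) * Real.pi ^ (m * n)) := by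
  have := rho_prob hN
  have hprob : IsProbabilityMeasure ((rho m n).map nrm) := Measure.isProbabilityMeasure_map nrm_meas.aemeasurable
  have hμ : μ = (rho m n).map nrm := by
    refine unique_inv _ _ h1 ?_ h2 ?_
    · rw [ae_map_iff nrm_meas.aemeasurable (measurableSet_eq_fun sqn_cont.measurable measurable_const)]
      have : ∀ᵐ v ∂(rho m n), v ≠ 0 := (withDensity_absolutelyContinuous _ _).ae_le (ae_ne_zero hN)
      filter_upwards [this] with v hv using nrm_sqn hv
    · intro U hU
      rw [Measure.map_map (mulVec_cont U).measurable nrm_meas]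
      have : (fun v => U *ᵥ v) ∘ nrm = nrm ∘ (fun v : Fin m × Fin n → ℂ => U *ᵥ v) := by
        ext1 v; exact (nrm_unit hU v).symm
      rw [this, ← Measure.map_map nrm_meas (mulVec_cont U).measurable, rho_unit hU]
  have e1 : ∫ ψ, vnEntropy (reducedDM ψ) ∂μ = ∫ ψ, HH ψ ∂μ := by
    refine integral_congr_ae ?_
    filter_upwards [h1] with v hv using HH_ent v hv
  rw [e1, hμ, integral_map nrm_meas.aemeasurable HH_meas.aestronglyMeasurable, rho,
    integral_withDensity_eq_integral_toReal_smul (f := fun v => ENNReal.ofReal (dens v)) (ENNReal.measurable_ofReal.comp dens_meas) (Filter.Eventually.of_forall fun _ => ENNReal.ofReal_lt_top),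
    ← integral_div]
  refine integral_congr_ae ?_
  filter_upwards [ae_ne_zero hN] with v hv
  rw [ENNReal.toReal_ofReal (dens_nonneg v), ← HH_nrm v hv, dens, smul_eq_mul]
  ring

lemma expV_int {ι : Type*} [Fintype ι] : Integrable fun v : ι → ℂ => Real.exp (-sqn v) := by
  by_contra h
  have h1 := gauss_V (ι := ι)
  rw [integral_undef h] at h1
  have := Real.pi_pos
  have : 0 < Real.pi ^ Fintype.card ι := by positivity
  linarith

lemma AAV_int {m n : ℕ} {t : ℝ} (ht : 0 < t) : Integrable fun v : Fin m × Fin n → ℂ => Real.exp (-sqn v) * AA t (TT v) := by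
  refine expV_int.mul_bdd (c := m) ?_ (Filter.Eventually.of_forall fun v => ?_)
  · simp_rw [AA_eq _ ht]
    have h3 : ∀ s : ℝ, Continuous fun v : Fin m × Fin n → ℂ => Ds s (TT v) := fun s => (Ds_cont' s).comp TT_cont
    refine Continuous.aestronglyMeasurable (continuous_finsetSum _ fun j _ => continuous_const.mul ((h3 j).div (h3 t) fun v => (Ds_pos ht _).ne'))
  · have h1 : ∀ i, 0 ≤ ev (TT v) i / (t + ev (TT v) i) ∧ ev (TT v) i / (t + ev (TT v) i) ≤ 1 := fun i => by
      have := ev_nonneg (TT v) i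
      exact ⟨by positivity, by rw [div_le_one (by positivity)]; linarith⟩
    rw [AA, Real.norm_of_nonneg (Finset.sum_nonneg fun i _ => (h1 i).1)]
    refine (Finset.sum_le_sum fun i _ => (h1 i).2).trans ?_
    simp

lemma Q1V_int {m n : ℕ} {t : ℝ} (ht : 0 < t) : Integrable fun v : Fin m × Fin n → ℂ => Real.exp (-sqn v) * (sqn v / (t + sqn v)) := by
  refine expV_int.mul_bdd (c := 1) ?_ (Filter.Eventually.of_forall fun v => ?_)
  · exact Continuous.aestronglyMeasurable (sqn_cont.div (continuous_const.add sqn_cont) fun v => by have := sqn_nonneg v; positivity)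
  · have := sqn_nonneg v
    rw [Real.norm_of_nonneg (by positivity), div_le_one (by positivity)]; linarith

lemma red2 {m n : ℕ} : ∫ v : Fin m × Fin n → ℂ, Real.exp (-sqn v) * HH v =
   ∫ t in Set.Ioi (0:ℝ), ((∫ v : Fin m × Fin n → ℂ, Real.exp (-sqn v) * AA t (TT v)) - ∫ v : Fin m × Fin n → ℂ, Real.exp (-sqn v) * (sqn v / (t + sqn v))) := by
  have e : ∀ t ∈ Set.Ioi (0:ℝ), ∀ v : Fin m × Fin n → ℂ, Real.exp (-sqn v) * qM (TT v) t = Real.exp (-sqn v) * AA t (TT v) - Real.exp (-sqn v) * (sqn v / (t + sqn v)) := by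
    intro t ht v
    rw [qM_eq _ ht, qq, TT_RR]; ring
  have h : Measurable (Function.uncurry fun (v : Fin m × Fin n → ℂ) t => Real.exp (-sqn v) * qM (TT v) t) := by
    have h1 : Measurable fun v : Fin m × Fin n → ℂ => Real.exp (-sqn v) := (Real.continuous_exp.comp sqn_cont.neg).measurable
    exact (h1.comp measurable_fst).mul qMT_meas
  have hs := swap_nonneg volume (volume.restrict (Set.Ioi (0:ℝ))) _ h ?_ ?_ ?_ ?_
  · simp_rw [HH_eq, ← integral_const_mul]
    rw [hs]
    refine setIntegral_congr_fun measurableSet_Ioi fun t ht => ?_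
    rw [← integral_sub (AAV_int ht) (Q1V_int ht)]
    exact integral_congr_ae (Filter.Eventually.of_forall (e t ht))
  · refine Filter.Eventually.of_forall fun v => (ae_restrict_iff' measurableSet_Ioi).2 (Filter.Eventually.of_forall fun t ht => ?_)
    rw [qM_eq _ ht]
    exact mul_nonneg (Real.exp_pos _).le (qq_nonneg ht _)
  · refine (ae_restrict_iff' measurableSet_Ioi).2 (Filter.Eventually.of_forall fun t ht => Filter.Eventually.of_forall fun v => ?_)
    rw [qM_eq _ ht]
    exact mul_nonneg (Real.exp_pos _).le (qq_nonneg ht _)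
  · refine Filter.Eventually.of_forall fun v => ?_
    refine Integrable.const_mul ?_ _
    exact (qq_int (TT v)).congr_fun (fun t ht => (qM_eq _ ht).symm) measurableSet_Ioi
  · refine (ae_restrict_iff' measurableSet_Ioi).2 (Filter.Eventually.of_forall fun t ht => ?_)
    exact ((AAV_int ht).sub (Q1V_int ht)).congr (Filter.Eventually.of_forall fun v => (e t ht v).symm)

lemma red3 {p n : ℕ} (hn : 0 < n) (μ : Measure (Fin (p+1) × Fin n → ℂ)) [IsProbabilityMeasure μ]
    (h1 : ∀ᵐ ψ ∂μ, sqn ψ = 1) (h2 : ∀ U ∈ Matrix.unitaryGroup (Fin (p+1) × Fin n) ℂ, μ.map (fun ψ => U *ᵥ ψ) = μ) :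
    (((p+1) * n : ℕ) : ℝ) * ∫ ψ, vnEntropy (reducedDM ψ) ∂μ =
    ∫ t in Set.Ioi (0:ℝ), ((p.factorial : ℝ)⁻¹ * (∫ r in Set.Ioi (0:ℝ), r ^ p * (Real.exp (-(t * r)) * (((1 + r) ^ n)⁻¹ * Qp n p (1 / (1 + r)) t)))
     - ∫ r in Set.Ioi (0:ℝ), Real.exp (-(t * r)) * (((p+1) * n : ℕ) * ((1 + r) ^ ((p+1) * n + 1))⁻¹)) := by
  have hN : 0 < (p+1) * n := by positivity
  have hN' : (0:ℝ) < ((p+1) * n : ℕ) := by exact_mod_cast hN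
  have hpi : 0 < Real.pi ^ ((p+1) * n) := by have := Real.pi_pos; positivity
  rw [red1 hN μ h1 h2, red2]
  have : ∫ t in Set.Ioi (0:ℝ), ((∫ v : Fin (p+1) × Fin n → ℂ, Real.exp (-sqn v) * AA t (TT v)) - ∫ v : Fin (p+1) × Fin n → ℂ, Real.exp (-sqn v) * (sqn v / (t + sqn v))) =
    ∫ t in Set.Ioi (0:ℝ), Real.pi ^ ((p+1) * n) * ((p.factorial : ℝ)⁻¹ * (∫ r in Set.Ioi (0:ℝ), r ^ p * (Real.exp (-(t * r)) * (((1 + r) ^ n)⁻¹ * Qp n p (1 / (1 + r)) t)))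
     - ∫ r in Set.Ioi (0:ℝ), Real.exp (-(t * r)) * (((p+1) * n : ℕ) * ((1 + r) ^ ((p+1) * n + 1))⁻¹)) := by
    refine setIntegral_congr_fun measurableSet_Ioi fun t ht => ?_
    rw [AA_V p n ht, Q1_V (p+1) n ht]
    ring
  rw [this, integral_const_mul]
  field_simp

lemma beta0 (d : ℕ) : IntegrableOn (fun r : ℝ => ((1 + r) ^ (d+2))⁻¹) (Set.Ioi 0) ∧
    ∫ r in Set.Ioi (0:ℝ), ((1 + r) ^ (d+2))⁻¹ = 1 / ((d:ℝ) + 1) := by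
  have hd : ∀ t ∈ Set.Ici (0:ℝ), HasDerivAt (fun t : ℝ => -(1 / ((d:ℝ) + 1)) * ((1 + t) ^ (d+1))⁻¹) (((1 + t) ^ (d+2))⁻¹) t := by
    intro t ht
    have ht : 0 ≤ t := ht
    have h1 := ((((hasDerivAt_id t).const_add 1).pow (d+1)).inv (by simp only [id, Pi.pow_apply]; positivity)).const_mul (-(1 / ((d:ℝ) + 1)))
    refine HasDerivAt.congr_deriv h1 ?_
    simp only [id, Pi.pow_apply]
    push_cast
    try simp only [Nat.add_sub_cancel]
    field_simp
    try ring
  have hp : ∀ t ∈ Set.Ioi (0:ℝ), 0 ≤ ((1 + t) ^ (d+2))⁻¹ := by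
    intro t ht
    have ht : 0 < t := ht
    positivity
  have hlim : Filter.Tendsto (fun t : ℝ => -(1 / ((d:ℝ) + 1)) * ((1 + t) ^ (d+1))⁻¹) Filter.atTop (nhds 0) := by
    have h1 : Filter.Tendsto (fun t : ℝ => ((1 + t) ^ (d+1))⁻¹) Filter.atTop (nhds 0) := by
      refine Filter.Tendsto.inv_tendsto_atTop ?_
      exact (Filter.tendsto_pow_atTop (by simp)).comp (Filter.tendsto_atTop_add_const_left _ _ Filter.tendsto_id)
    simpa using h1.const_mul (-(1 / ((d:ℝ) + 1)))
  refine ⟨integrableOn_Ioi_deriv_of_nonneg' hd hp hlim, ?_⟩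
  rw [integral_Ioi_of_hasDerivAt_of_nonneg' hd hp hlim]
  simp

lemma betaI (c : ℕ) : ∀ d : ℕ, IntegrableOn (fun r : ℝ => r ^ c * ((1 + r) ^ (c+2+d))⁻¹) (Set.Ioi 0) ∧
    ∫ r in Set.Ioi (0:ℝ), r ^ c * ((1 + r) ^ (c+2+d))⁻¹ = (c.factorial * d.factorial : ℝ) / (c+d+1).factorial := by
  induction c with
  | zero =>
    intro d
    have h := beta0 d
    simp only [pow_zero, one_mul, zero_add, Nat.add_comm 2 d]
    refine ⟨h.1, ?_⟩
    rw [h.2, Nat.factorial_succ]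
    have : (d.factorial : ℝ) ≠ 0 := by positivity
    push_cast
    field_simp
    simp
  | succ c ih =>
    intro d
    have e : ∀ r ∈ Set.Ioi (0:ℝ), r ^ c * ((1 + r) ^ (c+2+d))⁻¹ - r ^ c * ((1 + r) ^ (c+2+(d+1)))⁻¹ = r ^ (c+1) * ((1 + r) ^ (c+1+2+d))⁻¹ := by
      intro r hr
      have hr : 0 < r := hr
      rw [show c + 1 + 2 + d = (c + 2 + d) + 1 by ring, show c + 2 + (d+1) = (c + 2 + d) + 1 by ring, pow_succ (1 + r), pow_succ r]
      field_simp
      ring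
    refine ⟨((ih d).1.sub (ih (d+1)).1).congr_fun e measurableSet_Ioi, ?_⟩
    rw [← setIntegral_congr_fun measurableSet_Ioi e, integral_sub (ih d).1 (ih (d+1)).1, (ih d).2, (ih (d+1)).2]
    rw [show c + (d+1) + 1 = (c + d + 1) + 1 by ring, show c + 1 + d + 1 = (c + d + 1) + 1 by ring, Nat.factorial_succ (c+d+1), Nat.factorial_succ d, Nat.factorial_succ c]
    have : ((c+d+1).factorial : ℝ) ≠ 0 := by positivity
    push_cast
    field_simp
    ring

noncomputable def MM (k b : ℕ) (t : ℝ) : ℝ := ∫ r in Set.Ioi (0:ℝ), r ^ k * (Real.exp (-(t * r)) * ((1 + r) ^ b)⁻¹)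

lemma MM_int (k b : ℕ) {t : ℝ} (ht : 0 < t) : IntegrableOn (fun r : ℝ => r ^ k * (Real.exp (-(t * r)) * ((1 + r) ^ b)⁻¹)) (Set.Ioi 0) := by
  refine bdd_int k ht (by fun_prop) 1 fun r hr => ?_
  rw [abs_of_nonneg (by positivity)]
  exact inv_le_one_of_one_le₀ (one_le_pow₀ (by linarith))

lemma MM_R1 (k b : ℕ) {t : ℝ} (ht : 0 < t) : MM k b t - MM k (b+1) t = MM (k+1) (b+1) t := by
  unfold MM
  rw [← integral_sub (MM_int k b ht) (MM_int k (b+1) ht)]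
  refine setIntegral_congr_fun measurableSet_Ioi fun r hr => ?_
  have hr : 0 < r := hr
  simp only [pow_succ]
  field_simp
  ring

lemma MM_R2 (k b : ℕ) {t : ℝ} (ht : 0 < t) : (k+1) * MM k b t - t * MM (k+1) b t = b * MM (k+1) (b+1) t := by
  have hd : ∀ r ∈ Set.Ici (0:ℝ), HasDerivAt (fun r : ℝ => r ^ (k+1) * (Real.exp (-(t * r)) * ((1 + r) ^ b)⁻¹))
     ((k+1) * (r ^ k * (Real.exp (-(t * r)) * ((1 + r) ^ b)⁻¹)) - t * (r ^ (k+1) * (Real.exp (-(t * r)) * ((1 + r) ^ b)⁻¹)) - b * (r ^ (k+1) * (Real.exp (-(t * r)) * ((1 + r) ^ (b+1))⁻¹))) r := by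
    intro r hr
    have hr : 0 ≤ r := hr
    have h1 := hasDerivAt_pow (k+1) r
    have h2 : HasDerivAt (fun r : ℝ => Real.exp (-(t * r))) (Real.exp (-(t * r)) * (-(t * 1))) r := ((hasDerivAt_id r).const_mul t).neg.exp
    have h3 : HasDerivAt (fun r : ℝ => ((1 + r) ^ b)⁻¹) (-(b * (1 + r) ^ (b-1) * 1) / ((1 + r) ^ b) ^ 2) r := 
      (((hasDerivAt_id r).const_add 1).pow b).inv (by simp only [id, Pi.pow_apply]; positivity)
    refine HasDerivAt.congr_deriv (h1.mul (h2.mul h3)) ?_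
    simp only [Nat.add_sub_cancel]
    rcases b with _ | b
    · simp; ring
    · simp only [Nat.add_sub_cancel]
      push_cast
      field_simp
      ring
  have hlim : Filter.Tendsto (fun r : ℝ => r ^ (k+1) * (Real.exp (-(t * r)) * ((1 + r) ^ b)⁻¹)) Filter.atTop (nhds 0) := by
    have h1 : Filter.Tendsto (fun r : ℝ => r ^ (k+1) * Real.exp (-(t * r))) Filter.atTop (nhds 0) := by
      have := tendsto_rpow_mul_exp_neg_mul_atTop_nhds_zero (k+1 : ℕ) t ht
      refine this.congr fun r => ?_
      rw [Real.rpow_natCast, neg_mul]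
    refine squeeze_zero' ?_ ?_ h1
    · filter_upwards [Filter.eventually_gt_atTop 0] with r hr
      positivity
    · filter_upwards [Filter.eventually_gt_atTop 0] with r hr
      gcongr
      have : ((1 + r) ^ b)⁻¹ ≤ 1 := inv_le_one_of_one_le₀ (one_le_pow₀ (by linarith))
      exact mul_le_of_le_one_right (Real.exp_pos _).le this
  have i1 := (MM_int k b ht).const_mul ((k:ℝ)+1)
  have i2 := (MM_int (k+1) b ht).const_mul t
  have i3 := (MM_int (k+1) (b+1) ht).const_mul (b:ℝ)
  have h := integral_Ioi_of_hasDerivAt_of_tendsto' hd ((i1.sub i2).sub i3) hlim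
  have i12 : Integrable (fun x => ((k:ℝ)+1) * (x ^ k * (Real.exp (-(t * x)) * ((1 + x) ^ b)⁻¹)) - t * (x ^ (k+1) * (Real.exp (-(t * x)) * ((1 + x) ^ b)⁻¹))) (volume.restrict (Set.Ioi 0)) := i1.sub i2
  rw [integral_sub i12 i3, integral_sub i1 i2, integral_const_mul, integral_const_mul, integral_const_mul] at h
  simp only [ne_eq, Nat.add_eq_zero_iff, one_ne_zero, and_false, not_false_eq_true, zero_pow, zero_mul, sub_zero] at h
  unfold MM
  linarith

lemma gam (a : ℕ) {r : ℝ} (hr : 0 < r) : ∫ t in Set.Ioi (0:ℝ), t ^ a * Real.exp (-(r * t)) = a.factorial / r ^ (a+1) := by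
  have := Real.integral_rpow_mul_exp_neg_mul_Ioi (a := a + 1) (r := r) (by positivity) hr
  rw [Real.Gamma_nat_eq_factorial] at this
  rw [setIntegral_congr_fun (g := fun t : ℝ => t ^ ((a:ℝ) + 1 - 1) * Real.exp (-(r * t))) measurableSet_Ioi (fun t _ => by simp), this]
  rw [one_div, mul_comm, div_eq_mul_inv]
  congr 1
  rw [show (a:ℝ) + 1 = ((a+1 : ℕ) : ℝ) by push_cast; ring, Real.rpow_natCast, inv_pow]

lemma TI (a c d : ℕ) : IntegrableOn (fun t => t ^ a * MM (a+1+c) (c+2+d) t) (Set.Ioi 0) ∧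
    ∫ t in Set.Ioi (0:ℝ), t ^ a * MM (a+1+c) (c+2+d) t = a.factorial * ((c.factorial * d.factorial : ℝ) / (c+d+1).factorial) := by
  let F : ℝ → ℝ → ℝ := fun r t => t ^ a * (r ^ (a+1+c) * (Real.exp (-(t * r)) * ((1 + r) ^ (c+2+d))⁻¹))
  have hF : ∀ r t, F r t = (r ^ (a+1) * (r ^ c * ((1 + r) ^ (c+2+d))⁻¹)) * (t ^ a * Real.exp (-(r * t))) := by
    intro r t; simp only [F]; rw [mul_comm t r]; ring
  have hm : Measurable (Function.uncurry F) := by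
    unfold Function.uncurry; simp only [F]; fun_prop
  have hn : ∀ r ∈ Set.Ioi (0:ℝ), ∫ t in Set.Ioi (0:ℝ), F r t = a.factorial * (r ^ c * ((1 + r) ^ (c+2+d))⁻¹) := by
    intro r hr
    have hr : 0 < r := hr
    simp_rw [hF]
    rw [integral_const_mul, gam a hr]
    field_simp
  have hint : Integrable (Function.uncurry F) ((volume.restrict (Set.Ioi (0:ℝ))).prod (volume.restrict (Set.Ioi (0:ℝ)))) := by
    rw [integrable_prod_iff hm.aestronglyMeasurable]
    constructor
    · refine (ae_restrict_iff' measurableSet_Ioi).2 (Filter.Eventually.of_forall fun r hr => ?_)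
      simp only [Function.uncurry, hF]
      exact (base_int a hr).const_mul _
    · refine IntegrableOn.congr_fun ((betaI c d).1.const_mul (a.factorial : ℝ)) (fun r hr => ?_) measurableSet_Ioi
      simp only [Function.uncurry]
      rw [← hn r hr]
      refine setIntegral_congr_fun measurableSet_Ioi fun t ht => ?_
      have hr : 0 < r := hr
      have ht : 0 < t := ht
      simp only [F]
      rw [Real.norm_of_nonneg (by positivity)]
  have e : ∀ t, ∫ r in Set.Ioi (0:ℝ), F r t = t ^ a * MM (a+1+c) (c+2+d) t := by
    intro t
    simp only [F]
    rw [integral_const_mul, MM]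
  constructor
  · have := hint.integral_prod_right
    simp only [Function.uncurry, e] at this
    exact this
  · simp_rw [← e]
    rw [← integral_integral_swap hint, setIntegral_congr_fun measurableSet_Ioi hn, integral_const_mul, (betaI c d).2]

def HI (f : ℝ → ℝ) (v : ℝ) : Prop := IntegrableOn f (Set.Ioi 0) ∧ ∫ t in Set.Ioi (0:ℝ), f t = v

lemma HI.add {f g : ℝ → ℝ} {v w : ℝ} (hf : HI f v) (hg : HI g w) : HI (fun t => f t + g t) (v + w) :=
  ⟨hf.1.add hg.1, by rw [integral_add hf.1 hg.1, hf.2, hg.2]⟩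

lemma HI.sub {f g : ℝ → ℝ} {v w : ℝ} (hf : HI f v) (hg : HI g w) : HI (fun t => f t - g t) (v - w) :=
  ⟨hf.1.sub hg.1, by rw [integral_sub hf.1 hg.1, hf.2, hg.2]⟩

lemma HI.cmul {f : ℝ → ℝ} {v : ℝ} (c : ℝ) (hf : HI f v) : HI (fun t => c * f t) (c * v) :=
  ⟨hf.1.const_mul c, by rw [integral_const_mul, hf.2]⟩

lemma HI.sum {s : Finset ℕ} {f : ℕ → ℝ → ℝ} {v : ℕ → ℝ} (hf : ∀ i ∈ s, HI (f i) (v i)) : HI (fun t => ∑ i ∈ s, f i t) (∑ i ∈ s, v i) :=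
  ⟨integrable_finsetSum _ fun i hi => (hf i hi).1, by
    rw [integral_finsetSum _ fun i hi => (hf i hi).1]; exact Finset.sum_congr rfl fun i hi => (hf i hi).2⟩

lemma HI.congr {f g : ℝ → ℝ} {v w : ℝ} (hf : HI f v) (h : ∀ t, 0 < t → f t = g t) (hv : v = w) : HI g w :=
  ⟨hf.1.congr_fun (fun t ht => h t ht) measurableSet_Ioi, by
    rw [← hv, ← hf.2]; exact setIntegral_congr_fun measurableSet_Ioi fun t ht => (h t ht).symm⟩

lemma TI' (a c d k b : ℕ) (hk : k = a + 1 + c) (hb : b = c + 2 + d) : HI (fun t => t ^ a * MM k b t) (a.factorial * ((c.factorial * d.factorial : ℝ) / (c+d+1).factorial)) := by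
  subst hk hb
  exact TI a c d

lemma HI_D (q L : ℕ) : HI (fun t => MM 0 (q+1) t - MM 0 (q+1+L) t) ((harmonic (q+L) : ℝ) - harmonic q) := by
  induction L with
  | zero => 
    refine HI.congr (f := fun _ => 0) (v := 0) ⟨by simp, by simp⟩ (fun t _ => by simp) (by simp)
  | succ L ih =>
    have h := TI' 0 0 (q+L) 1 (q+L+2) (by ring) (by ring)
    refine HI.congr (ih.add h) (fun t ht => ?_) ?_
    · have := MM_R1 0 (q+1+L) ht
      rw [show q+1+(L+1) = q+1+L+1 by ring, show q+L+2 = q+1+L+1 by ring]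
      simp only [zero_add] at this
      rw [← this]; ring
    · rw [← add_assoc q L 1, harmonic_succ]
      simp only [zero_add]
      rw [Nat.factorial_succ]
      have : ((q+L).factorial : ℝ) ≠ 0 := by positivity
      push_cast
      field_simp
      simp
      ring

lemma HI_Phi (p q : ℕ) : HI (fun t => (p * MM 0 (q+1) t + MM 0 (q+2) t) - t ^ p / p.factorial * (p * MM p (q+1) t + MM p (q+2) t))
    ((p+1) * harmonic p) := by
  have key : ∀ j : ℕ, HI (fun t => t ^ j / j.factorial * (p * MM j (q+1) t + MM j (q+2) t) - t ^ (j+1) / (j+1).factorial * (p * MM (j+1) (q+1) t + MM (j+1) (q+2) t)) ((p+1) / (j+1)) := by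
    intro j
    have h1 := (TI' j 0 q (j+1) (q+2) (by ring) (by ring)).cmul (p * (q+1) / (j+1).factorial)
    have h2 := (TI' j 0 (q+1) (j+1) (q+3) (by ring) (by ring)).cmul ((q+2) / (j+1).factorial)
    refine HI.congr (h1.add h2) (fun t ht => ?_) ?_
    · have r1 := MM_R2 j (q+1) ht
      have r2 := MM_R2 j (q+2) ht
      push_cast at r1 r2
      have e1 : MM (j+1) (q+2) t * (q+1) = (j+1) * MM j (q+1) t - t * MM (j+1) (q+1) t := by rw [r1]; ring
      have e2 : MM (j+1) (q+3) t * (q+2) = (j+1) * MM j (q+2) t - t * MM (j+1) (q+2) t := by rw [r2]; ring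
      have : (j.factorial : ℝ) ≠ 0 := by positivity
      rw [Nat.factorial_succ, pow_succ]
      push_cast
      field_simp
      linear_combination (p:ℝ) * e1 + e2
    · simp only [zero_add]
      rw [Nat.factorial_succ (q+1), Nat.factorial_succ q, Nat.factorial_succ j]
      have : (j.factorial : ℝ) ≠ 0 := by positivity
      have : (q.factorial : ℝ) ≠ 0 := by positivity
      push_cast
      field_simp
      simp
      ring
  have hs := HI.sum (s := Finset.range p) fun j _ => key j
  refine HI.congr hs (fun t ht => ?_) ?_
  · rw [Finset.sum_range_sub' (fun j => t ^ j / j.factorial * (p * MM j (q+1) t + MM j (q+2) t))]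
    simp
  · rw [harmonic]
    push_cast
    rw [Finset.mul_sum]
    rfl

lemma HI_i (a d i : ℕ) : HI (fun t => ((i+1+a).factorial : ℝ)⁻¹ * (t ^ a * (i+2) * (i+2+d).descFactorial (i+2) * ((i+1+a).choose (i+2) * MM (i+1+a) (i+2+d) t + (i+1+a).choose (i+1) * MM (i+1+a) (i+2+d+1) t)))
    (((i+2+a) * (i+2+d) - (i+1) * (i+2)) / (i+1)) := by
  have h1 := (TI' a i d (i+1+a) (i+2+d) (by ring) (by ring)).cmul (((i+1+a).factorial : ℝ)⁻¹ * (i+2) * (i+2+d).descFactorial (i+2) * (i+1+a).choose (i+2))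
  have h2 := (TI' a i (d+1) (i+1+a) (i+2+d+1) (by ring) (by ring)).cmul (((i+1+a).factorial : ℝ)⁻¹ * (i+2) * (i+2+d).descFactorial (i+2) * (i+1+a).choose (i+1))
  refine HI.congr (h1.add h2) (fun t ht => by ring) ?_
  have f1 := Nat.factorial_mul_descFactorial (n := i+2+d) (k := i+2) (by omega)
  have f2 := Nat.choose_succ_right_eq (i+1+a) (i+1)
  have f3 := Nat.choose_mul_factorial_mul_factorial (n := i+1+a) (k := i+1) (by omega)
  rw [show i+2+d-(i+2) = d by omega, show i+2+d = (i+d+1)+1 by ring, Nat.factorial_succ (i+d+1)] at f1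
  rw [show i+1+a-(i+1) = a by omega] at f2 f3
  rw [Nat.factorial_succ i] at f3
  rw [show i+(d+1)+1 = (i+d+1)+1 by ring, Nat.factorial_succ (i+d+1), Nat.factorial_succ d, ← f3, show i+2+d = (i+d+1)+1 by ring]
  have g1 : ((d.factorial : ℝ)) * (((i+d+1)+1).descFactorial (i+2) : ℝ) = (i+d+1+1) * (i+d+1).factorial := by exact_mod_cast f1
  have g2 : ((i+1+a).choose (i+2) : ℝ) = (i+1+a).choose (i+1) * a / (i+2) := by
    rw [eq_div_iff (by positivity)]; exact_mod_cast f2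
  have hC : ((i+1+a).choose (i+1) : ℝ) ≠ 0 := by
    have := Nat.choose_pos (n := i+1+a) (k := i+1) (by omega)
    positivity
  have hD : (((i+d+1)+1).descFactorial (i+2) : ℝ) = (i+d+1+1) * (i+d+1).factorial / d.factorial := by
    rw [eq_div_iff (by positivity)]; rw [← g1]; ring
  rw [g2, hD]
  have : (i.factorial : ℝ) ≠ 0 := by positivity
  have : (d.factorial : ℝ) ≠ 0 := by positivity
  have : (a.factorial : ℝ) ≠ 0 := by positivity
  have : ((i+d+1).factorial : ℝ) ≠ 0 := by positivity
  push_cast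
  field_simp
  ring

lemma Q_expand (n p : ℕ) {t : ℝ} (ht : 0 < t) :
    (∫ r in Set.Ioi (0:ℝ), r ^ p * (Real.exp (-(t * r)) * (((1 + r) ^ n)⁻¹ * Qp n p (1 / (1 + r)) t))) =
    ∑ i ∈ Finset.range (p+1), t ^ (p-i) * (i+1) * n.descFactorial (i+1) * (p.choose (i+1) * MM p n t + p.choose i * MM p (n+1) t) := by
  have e : ∀ r ∈ Set.Ioi (0:ℝ), r ^ p * (Real.exp (-(t * r)) * (((1 + r) ^ n)⁻¹ * Qp n p (1 / (1 + r)) t)) =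
     ∑ i ∈ Finset.range (p+1), (t ^ (p-i) * (i+1) * n.descFactorial (i+1) * p.choose (i+1) * (r ^ p * (Real.exp (-(t * r)) * ((1 + r) ^ n)⁻¹))
      + t ^ (p-i) * (i+1) * n.descFactorial (i+1) * p.choose i * (r ^ p * (Real.exp (-(t * r)) * ((1 + r) ^ (n+1))⁻¹))) := by
    intro r hr
    have hr : 0 < r := hr
    have hq : Qp n p (1 / (1 + r)) t = ∑ i ∈ Finset.range (p+1), (t ^ (p-i) * (i+1) * n.descFactorial (i+1) * p.choose (i+1) + t ^ (p-i) * (i+1) * n.descFactorial (i+1) * p.choose i * (1 / (1 + r))) := by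
      rw [Qp]
      simp_rw [mul_add]
      rw [Finset.sum_add_distrib, Finset.sum_add_distrib]
      congr 1
      · rw [Finset.sum_range_succ', Finset.sum_range_succ]
        simp only [Nat.choose_succ_self, Nat.cast_zero, mul_zero, add_zero, zero_mul]
        refine Finset.sum_congr rfl fun i _ => ?_
        rw [show p + 1 - (i+1) = p - i by omega]
        push_cast
        ring
      · exact Finset.sum_congr rfl fun i _ => by ring
    rw [hq, Finset.mul_sum, Finset.mul_sum, Finset.mul_sum]
    refine Finset.sum_congr rfl fun i _ => ?_
    rw [pow_succ]
    field_simp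
  rw [setIntegral_congr_fun measurableSet_Ioi e, integral_finsetSum]
  · refine Finset.sum_congr rfl fun i _ => ?_
    rw [integral_add ((MM_int p n ht).const_mul _) ((MM_int p (n+1) ht).const_mul _), integral_const_mul, integral_const_mul, ← MM, ← MM]
    ring
  · intro i _
    exact ((MM_int p n ht).const_mul _).add ((MM_int p (n+1) ht).const_mul _)

lemma sum_val (p n : ℕ) : ∑ i ∈ Finset.range p, (((p:ℝ)+1) * n - (i+1) * (i+2)) / (i+1) = (p+1) * n * harmonic p - (p * (p+3) / 2 : ℝ) := by
  have h : ∀ i ∈ Finset.range p, (((p:ℝ)+1) * n - (i+1) * (i+2)) / (i+1) = (p+1) * n * ((i+1 : ℝ))⁻¹ - (i + 2) := by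
    intro i _
    field_simp
  rw [Finset.sum_congr rfl h, Finset.sum_sub_distrib, ← Finset.mul_sum, harmonic]
  push_cast
  congr 1
  clear h
  induction p with
  | zero => simp
  | succ p ih => rw [Finset.sum_range_succ, ih]; push_cast; ring

lemma page_HI (p q : ℕ) (hpq : p ≤ q) : HI (fun t => (p.factorial : ℝ)⁻¹ * (∫ r in Set.Ioi (0:ℝ), r ^ p * (Real.exp (-(t * r)) * (((1 + r) ^ (q+1))⁻¹ * Qp (q+1) p (1 / (1 + r)) t)))
     - ∫ r in Set.Ioi (0:ℝ), Real.exp (-(t * r)) * (((p+1) * (q+1) : ℕ) * ((1 + r) ^ ((p+1) * (q+1) + 1))⁻¹))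
     ((p+1) * (q+1) * ((harmonic ((p+1) * (q+1)) : ℝ) - harmonic (q+1)) - (p+1) * p / 2) := by
  have hi : ∀ i ∈ Finset.range p, HI (fun t => (p.factorial : ℝ)⁻¹ * (t ^ (p-(i+1)) * (((i+1:ℕ):ℝ)+1) * (q+1).descFactorial (i+1+1) * (p.choose (i+1+1) * MM p (q+1) t + p.choose (i+1) * MM p (q+1+1) t))) ((((p:ℝ)+1) * (q+1:ℕ) - (i+1) * (i+2)) / (i+1)) := by
    intro i hi
    rw [Finset.mem_range] at hi
    obtain ⟨a, rfl⟩ := Nat.exists_eq_add_of_le (show i + 1 ≤ p by omega)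
    obtain ⟨d, hd⟩ := Nat.exists_eq_add_of_le (show i + 2 ≤ q + 1 by omega)
    rw [hd]
    refine HI.congr (HI_i a d i) (fun t ht => ?_) ?_
    · rw [show i + 1 + a - (i + 1) = a by omega]
      push_cast
      ring_nf
    · push_cast
      ring
  obtain ⟨L, hL⟩ := Nat.exists_eq_add_of_le (show q + 1 ≤ (p+1) * (q+1) by nlinarith)
  have h1 := HI.sum hi
  have h2 := (HI_Phi p q).cmul ((q:ℝ)+1)
  have h3 := (HI_D q (L+1)).cmul (((q:ℝ)+1)*p)
  have h4 := (HI_D (q+1) L).cmul ((q:ℝ)+1)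
  refine HI.congr (((h1.sub h2).add h3).add h4) (fun t ht => ?_) ?_
  · have hq1 : ∫ r in Set.Ioi (0:ℝ), Real.exp (-(t * r)) * (((p+1) * (q+1) : ℕ) * ((1 + r) ^ ((p+1) * (q+1) + 1))⁻¹) = (p+1)*(q+1) * MM 0 ((p+1) * (q+1) + 1) t := by
      rw [MM, ← integral_const_mul]
      refine integral_congr_ae (Filter.Eventually.of_forall fun r => ?_)
      push_cast
      ring
    rw [hq1, Q_expand _ _ ht, Finset.sum_range_succ', ← Finset.mul_sum, hL,
      show q+1+(L+1) = q+1+L+1 by ring, show q+1+1+L = q+1+L+1 by ring]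
    have hL' : ((p:ℝ)+1)*(q+1) = q+1+L := by exact_mod_cast hL
    simp only [Nat.sub_zero, Nat.cast_zero, zero_add, Nat.descFactorial_one, Nat.choose_one_right, Nat.choose_zero_right, Nat.cast_one, Nat.cast_add]
    ring
  · rw [sum_val, show q + (L+1) = q+1+L by ring, ← hL, harmonic_succ q]
    push_cast
    field_simp
    ring

lemma page_formula {p q : ℕ} (hpq : p ≤ q) (μ : Measure (Fin (p+1) × Fin (q+1) → ℂ)) [IsProbabilityMeasure μ]
    (h1 : ∀ᵐ ψ ∂μ, sqn ψ = 1) (h2 : ∀ U ∈ Matrix.unitaryGroup (Fin (p+1) × Fin (q+1)) ℂ, μ.map (fun ψ => U *ᵥ ψ) = μ) :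
    ∫ ψ, vnEntropy (reducedDM ψ) ∂μ = (harmonic ((p+1) * (q+1)) : ℝ) - harmonic (q+1) - p / (2 * (q+1)) := by
  have h := red3 (n := q+1) (by omega) μ h1 h2
  rw [(page_HI p q hpq).2] at h
  push_cast at h
  have e : ((p:ℝ)+1) * (q+1) * ∫ ψ, vnEntropy (reducedDM ψ) ∂μ = ((p:ℝ)+1) * (q+1) * ((harmonic ((p+1) * (q+1)) : ℝ) - harmonic (q+1) - p / (2 * (q+1))) := by
    rw [h]; field_simp
  exact mul_left_cancel₀ (by positivity) e

lemma step_bound (k : ℕ) (hk : 0 < k) : |1 / (2 * (k:ℝ)) + 1 / (2 * (k+1)) - (Real.log (k+1) - Real.log k)| ≤ 1 / (k:ℝ)^2 - 1 / ((k:ℝ)+1)^2 := by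
  have hk' : (0:ℝ) < k := by exact_mod_cast hk
  have hx : |1 / ((k:ℝ)+1)| < 1 := by
    rw [abs_of_pos (by positivity), div_lt_one (by positivity)]; linarith
  have h := Real.abs_log_sub_add_sum_range_le hx 2
  rw [abs_of_pos (show 0 < 1 / ((k:ℝ)+1) by positivity)] at h
  have hl : Real.log (1 - 1 / ((k:ℝ)+1)) = Real.log k - Real.log (k+1) := by
    rw [← Real.log_div hk'.ne' (by positivity)]
    congr 1
    field_simp
    ring
  rw [hl] at h
  simp only [Finset.sum_range_succ, Finset.sum_range_zero] at h
  have e1 : (1 / ((k:ℝ)+1)) ^ (2+1) / (1 - 1 / ((k:ℝ)+1)) = 1 / (k * (k+1)^2) := by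
    have : 1 - 1 / ((k:ℝ)+1) = k / (k+1) := by field_simp; ring
    rw [this, div_pow, one_pow]; field_simp
  rw [e1] at h
  have e2 : 1 / (2 * (k:ℝ)) + 1 / (2 * (k+1)) = 1 / (k+1) + (1/(k+1))^2/2 + 1 / (2 * k * (k+1)^2) := by
    field_simp; ring
  have e3 : 1 / (k * ((k:ℝ)+1)^2) + 1 / (2 * k * (k+1)^2) ≤ 1 / (k:ℝ)^2 - 1 / ((k:ℝ)+1)^2 := by
    have : 1 / (k:ℝ)^2 - 1 / ((k:ℝ)+1)^2 - (1 / (k * ((k:ℝ)+1)^2) + 1 / (2 * k * (k+1)^2)) = (k/2 + 1) / (k^2 * (k+1)^2) := by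
      field_simp; ring
    have : 0 ≤ (k/2 + 1) / ((k:ℝ)^2 * (k+1)^2) := by positivity
    linarith
  have e4 : 0 ≤ 1 / (2 * (k:ℝ) * (k+1)^2) := by positivity
  rw [e2]
  norm_num at h ⊢
  rw [abs_le] at h ⊢
  norm_num at e3 e4
  constructor <;> linarith [h.1, h.2]

lemma tele_bound (n L : ℕ) (hn : 0 < n) :
    |((harmonic (n+L) : ℝ) - Real.log (n+L:ℕ) - 1 / (2 * (n+L:ℕ))) - ((harmonic n : ℝ) - Real.log n - 1 / (2 * n))| ≤ 1 / (n:ℝ)^2 - 1 / ((n+L:ℕ):ℝ)^2 := by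
  induction L with
  | zero => simp
  | succ L ih =>
    have h := step_bound (n+L) (by omega)
    have := abs_add_le (((harmonic (n+L) : ℝ) - Real.log (n+L:ℕ) - 1 / (2 * (n+L:ℕ))) - ((harmonic n : ℝ) - Real.log n - 1 / (2 * n))) (1 / (2 * ((n+L:ℕ):ℝ)) + 1 / (2 * ((n+L:ℕ)+1)) - (Real.log ((n+L:ℕ)+1) - Real.log (n+L:ℕ)))
    have e : ((harmonic (n+(L+1)) : ℝ) - Real.log (n+(L+1):ℕ) - 1 / (2 * (n+(L+1):ℕ))) - ((harmonic n : ℝ) - Real.log n - 1 / (2 * n)) =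
      (((harmonic (n+L) : ℝ) - Real.log (n+L:ℕ) - 1 / (2 * (n+L:ℕ))) - ((harmonic n : ℝ) - Real.log n - 1 / (2 * n))) + (1 / (2 * ((n+L:ℕ):ℝ)) + 1 / (2 * ((n+L:ℕ)+1)) - (Real.log ((n+L:ℕ)+1) - Real.log (n+L:ℕ))) := by
      rw [← add_assoc n L 1, harmonic_succ]
      generalize n + L = K
      push_cast
      have : ((K:ℝ)+1)⁻¹ = 1 / (2 * (K+1)) + 1 / (2 * (K+1)) := by field_simp; norm_num
      rw [this]
      ring
    rw [e]
    have e5 : ((n+(L+1):ℕ):ℝ) = ((n+L:ℕ):ℝ) + 1 := by push_cast; ring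
    rw [e5]
    linarith

/-- there is an absolute constant `C > 0` such that for all `d_A ≤ d_Ā`, the
average entanglement entropy of a Haar-random pure state on `ℂ^{d_A} ⊗ ℂ^{d_Ā}` equals
`ln d_A − d_A/(2 d_Ā) + ε` with `|ε| ≤ C/(d_A d_Ā)`. -/
theorem page_average_entanglement_entropy_asymptotic :
    ∃ C : ℝ, 0 < C ∧
      ∀ (dA dB : ℕ), 0 < dA → dA ≤ dB →
        ∀ (μ : Measure (Fin dA × Fin dB → ℂ)), IsProbabilityMeasure μ →
          (∀ᵐ ψ ∂μ, ∑ i, Complex.normSq (ψ i) = 1) →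
          (∀ U ∈ Matrix.unitaryGroup (Fin dA × Fin dB) ℂ,
            μ.map (fun ψ => U.mulVec ψ) = μ) →
          ∃ ε : ℝ,
            (∫ ψ, vnEntropy (reducedDM ψ) ∂μ) =
              Real.log dA - (dA : ℝ) / (2 * dB) + ε ∧
            |ε| ≤ C / ((dA : ℝ) * dB) := by
  refine ⟨2, by norm_num, ?_⟩
  intro dA dB hA hAB μ hμ h1 h2
  obtain ⟨p, rfl⟩ := Nat.exists_eq_succ_of_ne_zero hA.ne'
  obtain ⟨q, rfl⟩ := Nat.exists_eq_succ_of_ne_zero (show dB ≠ 0 by omega)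
  have hpq : p ≤ q := by omega
  have hp := page_formula hpq μ h1 h2
  simp only [Nat.succ_eq_add_one]
  refine ⟨(∫ ψ, vnEntropy (reducedDM ψ) ∂μ) - (Real.log (p+1:ℕ) - ((p+1:ℕ) : ℝ) / (2 * (q+1:ℕ))), by ring, ?_⟩
  rw [hp]
  obtain ⟨L, hL⟩ := Nat.exists_eq_add_of_le (show q + 1 ≤ (p+1) * (q+1) by nlinarith)
  have hb := tele_bound (q+1) L (by omega)
  rw [← hL] at hb
  have hlog : Real.log (((p+1)*(q+1):ℕ):ℝ) = Real.log (p+1) + Real.log (q+1) := by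
    push_cast
    exact Real.log_mul (by positivity) (by positivity)
  rw [hlog] at hb
  push_cast at hb ⊢
  set P : ℝ := (p:ℝ)+1 with hP
  set Q : ℝ := (q:ℝ)+1 with hQ
  have hP0 : 0 < P := by positivity
  have hQ0 : 0 < Q := by positivity
  have hPQ : P ≤ Q := by have : (p:ℝ) ≤ q := by exact_mod_cast hpq
                         linarith
  have b1 : 1 / Q^2 ≤ 1 / (P * Q) := by
    apply one_div_le_one_div_of_le (by positivity)
    rw [sq]; gcongr
  have b2 : 0 ≤ 1 / (P * Q)^2 := by positivity
  have b3 : 0 ≤ 1 / (P * Q) := by positivity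
  have e1 : 1 / (2 * (P * Q)) = (1 / (P * Q)) / 2 := by field_simp
  have e2 : (2:ℝ) / (P * Q) = 2 * (1 / (P * Q)) := by ring
  have e3 : (p:ℝ) / (2 * Q) = P / (2 * Q) - 1 / (2 * Q) := by rw [hP]; ring
  rw [e2, e3]
  rw [e1] at hb
  rw [abs_le] at hb ⊢
  constructor <;> linarith [hb.1, hb.2]
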